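/- arXiv:1907.07102 — 2 statements merged into one kernel-verified Lean document; each statement's English description precedes it below -/
import Mathlib

section
/- Let Ω ⊂ ℝ^{n+1} be open, x ∈ Ω, y ∈ ∂Ω. If there exists a λ-carrot path from y to x (a rectifiable curve γ with endpoints y and x, with γ∖{y} ⊂ Ω, such that λ·ℓ(γ(y,z)) ≤ dist(z,∂Ω) for all z ∈ γ), then there exists a C-good Harnack chain from x to y, i.e. a sequence of balls B₁,B₂,… ⊂ Ω with x ∈ B₁, dist(y,Bⱼ) → 0, consecutive balls intersecting, C⁻¹ dist(Bⱼ,∂Ω) ≤ r(Bⱼ) ≤ C dist(Bⱼ,∂Ω), radii quasi-monotone (r(Bⱼ) ≤ C r(Bᵢ) for j > i), and at most C balls with radius in (t,2t] for each t > 0; conversely, the existence of such a C-good Harnack chain from x to y implies the existence of a λ'-carrot path from y to x, with constants depending only on each other. -/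
open Set Metric MeasureTheory Filter Topology
open scoped ENNReal

noncomputable section

/-- Distance between two sets. -/
def setDist {α : Type*} [PseudoMetricSpace α] (s t : Set α) : ℝ :=
  sInf (Set.image2 dist s t)

/-- A `lam`-carrot path in `Ω` from `y ∈ ∂Ω` to `x ∈ Ω`: a rectifiable curve `γ : [0,1] → ℝ^{n+1}`
with `γ 0 = y`, `γ 1 = x`, `γ ∖ {y} ⊂ Ω`, such that for every point `z = γ t` of the curve,
`lam` times the arclength of the subpath from `y` to `z` is at most `dist(z, ∂Ω)`. -/
def IsCarrotPath {n : ℕ} (Ω : Set (EuclideanSpace ℝ (Fin (n+1)))) (lam : ℝ)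
    (γ : ℝ → EuclideanSpace ℝ (Fin (n+1)))
    (y x : EuclideanSpace ℝ (Fin (n+1))) : Prop :=
  ContinuousOn γ (Icc 0 1) ∧ γ 0 = y ∧ γ 1 = x ∧
  (∀ t ∈ Ioc (0:ℝ) 1, γ t ∈ Ω) ∧
  eVariationOn γ (Icc (0:ℝ) 1) ≠ ⊤ ∧
  ∀ t ∈ Icc (0:ℝ) 1,
    ENNReal.ofReal lam * eVariationOn γ (Icc (0:ℝ) t) ≤
      ENNReal.ofReal (Metric.infDist (γ t) (frontier Ω))

/-- A `C`-good (Harnack) chain of balls in `Ω` from `x ∈ Ω` to `y ∈ ∂Ω`: a sequence of balls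
`B j = B(c j, r j) ⊂ Ω` with `x ∈ B 0`, `dist(y, B j) → 0`, consecutive balls intersecting,
`C⁻¹ dist(B j, ∂Ω) ≤ r j ≤ C dist(B j, ∂Ω)`, radii quasi-monotone (`r j ≤ C r i` for `i < j`),
and at most `C` balls with radius in `(t, 2t]` for every `t > 0`. -/
def IsGoodChain {n : ℕ} (Ω : Set (EuclideanSpace ℝ (Fin (n+1)))) (C : ℝ)
    (c : ℕ → EuclideanSpace ℝ (Fin (n+1))) (r : ℕ → ℝ)
    (x y : EuclideanSpace ℝ (Fin (n+1))) : Prop :=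
  (∀ j, 0 < r j) ∧
  (∀ j, ball (c j) (r j) ⊆ Ω) ∧
  x ∈ ball (c 0) (r 0) ∧
  Tendsto (fun j => Metric.infDist y (ball (c j) (r j))) atTop (nhds 0) ∧
  (∀ j, (ball (c j) (r j) ∩ ball (c (j+1)) (r (j+1))).Nonempty) ∧
  (∀ j, C⁻¹ * setDist (ball (c j) (r j)) (frontier Ω) ≤ r j ∧
        r j ≤ C * setDist (ball (c j) (r j)) (frontier Ω)) ∧
  (∀ i j, i < j → r j ≤ C * r i) ∧
  ∀ t : ℝ, 0 < t →
    {j | t < r j ∧ r j ≤ 2 * t}.Finite ∧ ({j | t < r j ∧ r j ≤ 2 * t}.ncard : ℝ) ≤ C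


lemma ball_sub_of_frontier {E : Type*} [NormedAddCommGroup E] [NormedSpace ℝ E] {Ω : Set E}
    (hΩ : IsOpen Ω) {c : E} {r : ℝ} (hr : 0 < r) (hc : c ∈ Ω)
    (h : r ≤ infDist c (frontier Ω)) : ball c r ⊆ Ω := by
  have hpc : IsPreconnected (ball c r) := (convex_ball c r).isPreconnected
  refine hpc.subset_left_of_subset_union hΩ (isClosed_closure (s := Ω)).isOpen_compl ?_ ?_ ?_
  · exact (disjoint_compl_right (a := closure Ω)).mono_left subset_closure
  · intro z hz
    by_contra hcon
    simp only [mem_union, mem_compl_iff, not_or, not_not] at hcon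
    have hf : z ∈ frontier Ω := by
      rw [hΩ.frontier_eq]; exact ⟨hcon.2, hcon.1⟩
    have := infDist_le_dist_of_mem (x := c) hf
    rw [mem_ball, dist_comm] at hz
    linarith
  · exact ⟨c, mem_ball_self hr, hc⟩

lemma setDist_le_infDist {E : Type*} [PseudoMetricSpace E] {s t : Set E} (ht : t.Nonempty) {z : E}
    (hz : z ∈ s) : setDist s t ≤ infDist z t := by
  rw [le_infDist ht]
  intro w hw
  exact csInf_le ⟨0, by rintro _ ⟨a, _, b, _, rfl⟩; exact dist_nonneg⟩ ⟨z, hz, w, hw, rfl⟩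

lemma le_setDist_ball {E : Type*} [PseudoMetricSpace E] {t : Set E} (ht : t.Nonempty) {c : E}
    {r d : ℝ} (hr : 0 < r) (h : d + r ≤ infDist c t) : d ≤ setDist (ball c r) t := by
  obtain ⟨w, hw⟩ := ht
  refine le_csInf ⟨_, c, mem_ball_self hr, w, hw, rfl⟩ ?_
  rintro _ ⟨a, ha, b, hb, rfl⟩
  have h1 := infDist_le_dist_of_mem (x := c) hb
  have h2 := dist_triangle c a b
  rw [mem_ball, dist_comm] at ha
  linarith

/-- arclength parametrisation -/
lemma exists_arclength {E : Type*} [PseudoMetricSpace E] {γ : ℝ → E}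
    (hc : ContinuousOn γ (Icc 0 1)) (hv : eVariationOn γ (Icc (0:ℝ) 1) ≠ ⊤) :
    ∃ (l : ℝ) (τ : ℝ → ℝ), eVariationOn γ (Icc (0:ℝ) 1) = ENNReal.ofReal l ∧ 0 ≤ l ∧
      (∀ s ∈ Icc 0 l, τ s ∈ Icc (0:ℝ) 1 ∧ eVariationOn γ (Icc (0:ℝ) (τ s)) = ENNReal.ofReal s) ∧
      τ l = 1 ∧
      (∀ s ∈ Icc 0 l, ∀ s' ∈ Icc 0 l, s ≤ s' → dist (γ (τ s)) (γ (τ s')) ≤ s' - s) := by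
  set V : ℝ → ℝ → ℝ := fun a b => (eVariationOn γ (Icc (0:ℝ) 1 ∩ Icc a b)).toReal with hV
  have hfin : ∀ a b, eVariationOn γ (Icc (0:ℝ) 1 ∩ Icc a b) ≠ ⊤ := fun a b =>
    ne_top_of_le_ne_top hv (eVariationOn.mono _ inter_subset_left)
  have hadd : ∀ a b c, a ≤ b → b ≤ c → b ∈ Icc (0:ℝ) 1 → V a b + V b c = V a c := by
    intro a b c h1 h2 h3
    simp only [hV]
    rw [← ENNReal.toReal_add (hfin _ _) (hfin _ _), eVariationOn.Icc_add_Icc γ h1 h2 h3]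
  have hbv : BoundedVariationOn γ (Icc (0:ℝ) 1) := hv
  have hcont : ContinuousOn (V 0) (Icc 0 1) := by
    intro t ht
    have h1 := hbv.tendsto_eVariationOn_Icc_zero_left (x := t) ((hc t ht).mono inter_subset_left)
    have h2 := hbv.tendsto_eVariationOn_Icc_zero_right t ((hc t ht).mono inter_subset_left)
    have h1' := (ENNReal.tendsto_toReal ENNReal.zero_ne_top).comp h1
    have h2' := (ENNReal.tendsto_toReal ENNReal.zero_ne_top).comp h2
    have h3 := h1'.add h2'
    simp only [ENNReal.toReal_zero, add_zero] at h3
    rw [ContinuousWithinAt, tendsto_iff_dist_tendsto_zero]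
    refine squeeze_zero' (Eventually.of_forall fun _ => dist_nonneg) ?_ h3
    filter_upwards [self_mem_nhdsWithin] with u hu
    have p1 : 0 ≤ V u t := ENNReal.toReal_nonneg
    have p2 : 0 ≤ V t u := ENNReal.toReal_nonneg
    change dist (V 0 u) (V 0 t) ≤ V u t + V t u
    rw [Real.dist_eq, abs_le]
    rcases le_total u t with h | h
    · have := hadd 0 u t hu.1 h hu
      constructor <;> linarith
    · have := hadd 0 t u ht.1 h ht
      constructor <;> linarith
  have h00 : V 0 0 = 0 := by
    simp only [hV]
    rw [eVariationOn.subsingleton _ (by intro a ha b hb; have := ha.2; have := hb.2; simp_all)]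
    rfl
  have hivt := intermediate_value_Icc (zero_le_one) hcont
  rw [h00] at hivt
  have hEq : ∀ t ∈ Icc (0:ℝ) 1, eVariationOn γ (Icc (0:ℝ) t) = ENNReal.ofReal (V 0 t) := by
    intro t ht
    rw [hV]; dsimp only
    rw [ENNReal.ofReal_toReal (hfin _ _), inter_eq_self_of_subset_right (Icc_subset_Icc le_rfl ht.2)]
  have hch : ∀ s, ∃ t, s ∈ Icc 0 (V 0 1) → t ∈ Icc (0:ℝ) 1 ∧ V 0 t = s := by
    intro s
    by_cases hs : s ∈ Icc 0 (V 0 1)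
    · obtain ⟨t, ht, h⟩ := hivt hs
      exact ⟨t, fun _ => ⟨ht, h⟩⟩
    · exact ⟨0, fun h => absurd h hs⟩
  choose τ hτ using hch
  have key : ∀ a ∈ Icc (0:ℝ) 1, ∀ b ∈ Icc (0:ℝ) 1, a ≤ b → dist (γ a) (γ b) ≤ V 0 b - V 0 a := by
    intro a ha b hb hab
    have h1 := hadd 0 a b ha.1 hab ha
    have h2 : edist (γ a) (γ b) ≤ eVariationOn γ (Icc (0:ℝ) 1 ∩ Icc a b) :=
      eVariationOn.edist_le γ ⟨ha, le_rfl, hab⟩ ⟨hb, hab, le_rfl⟩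
    have h3 : dist (γ a) (γ b) ≤ V a b := by
      rw [dist_edist]; exact ENNReal.toReal_mono (hfin _ _) h2
    linarith
  refine ⟨V 0 1, fun s => if s = V 0 1 then 1 else τ s, hEq 1 (by simp), ENNReal.toReal_nonneg, ?_, by simp, ?_⟩
  all_goals
    have hτ' : ∀ s ∈ Icc 0 (V 0 1), (if s = V 0 1 then 1 else τ s) ∈ Icc (0:ℝ) 1 ∧
        V 0 (if s = V 0 1 then 1 else τ s) = s := by
      intro s hs
      split_ifs with h
      · exact ⟨by simp, h.symm⟩
      · exact hτ s hs
  · intro s hs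
    refine ⟨(hτ' s hs).1, ?_⟩
    dsimp only
    rw [hEq _ (hτ' s hs).1, (hτ' s hs).2]
  · intro s hs s' hs' h
    dsimp only
    obtain ⟨a1, a2⟩ := hτ' s hs
    obtain ⟨b1, b2⟩ := hτ' s' hs'
    rcases le_total (if s = V 0 1 then 1 else τ s) (if s' = V 0 1 then 1 else τ s') with g | g
    · have := key _ a1 _ b1 g
      linarith
    · have := key _ b1 _ a1 g
      rw [dist_comm]
      linarith

lemma forward (n : ℕ) (lam : ℝ) (h0 : 0 < lam) (h1 : lam < 1) : ∃ C : ℝ, 0 < C ∧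
      ∀ (Ω : Set (EuclideanSpace ℝ (Fin (n+1)))) (x y : EuclideanSpace ℝ (Fin (n+1))),
        IsOpen Ω → x ∈ Ω → y ∈ frontier Ω →
        (∃ γ, IsCarrotPath Ω lam γ y x) →
        ∃ c r, IsGoodChain Ω C c r x y := by
  obtain ⟨k, hk⟩ := exists_pow_lt_of_lt_one (show (0:ℝ) < 1/2 by norm_num)
    (show 1 - lam/4 < 1 by linarith)
  set q := 1 - lam/4 with hq
  have hq0 : 0 < q := by linarith
  have hq1 : q < 1 := by linarith
  have hl2 : 0 < 2 / lam := by positivity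
  have hk0 : (0:ℝ) ≤ k := Nat.cast_nonneg _
  refine ⟨2/lam + k + 1, by positivity, ?_⟩
  set C := 2/lam + k + 1 with hC
  have hC1 : 1 ≤ C := by linarith
  have hC2 : 2/lam ≤ C := by linarith
  rintro Ω x y hΩ hx hy ⟨γ, hcont, hy0, hx1, hin, hvar, hcar⟩
  obtain ⟨l, τ, hl, hl0, hτ, hτl, hd⟩ := exists_arclength hcont hvar
  have hxy : 0 < dist x y := by
    rw [dist_pos]; rintro rfl
    rw [hΩ.frontier_eq] at hy; exact hy.2 hx
  have hlpos : 0 < l := by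
    have : edist (γ 1) (γ 0) ≤ eVariationOn γ (Icc (0:ℝ) 1) :=
      eVariationOn.edist_le γ (by simp) (by simp)
    rw [hl, hx1, hy0, edist_dist] at this
    exact hxy.trans_le ((ENNReal.ofReal_le_ofReal_iff hl0).1 this)
  have hτ0 : ∀ s ∈ Icc 0 l, dist (γ (τ s)) y ≤ s := by
    intro s hs
    have : edist (γ (τ s)) (γ 0) ≤ eVariationOn γ (Icc (0:ℝ) (τ s)) :=
      eVariationOn.edist_le γ ⟨(hτ s hs).1.1, le_rfl⟩ ⟨le_rfl, (hτ s hs).1.1⟩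
    rw [(hτ s hs).2, hy0, edist_dist] at this
    exact (ENNReal.ofReal_le_ofReal_iff hs.1).1 this
  have hδ : ∀ s ∈ Icc 0 l, lam * s ≤ infDist (γ (τ s)) (frontier Ω) := by
    intro s hs
    have := hcar _ (hτ s hs).1
    rw [(hτ s hs).2, ← ENNReal.ofReal_mul h0.le] at this
    exact (ENNReal.ofReal_le_ofReal_iff infDist_nonneg).1 this
  have hδ2 : ∀ s ∈ Icc 0 l, infDist (γ (τ s)) (frontier Ω) ≤ s := fun s hs =>
    (infDist_le_dist_of_mem hy).trans (hτ0 s hs)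
  have hmem : ∀ s ∈ Icc 0 l, 0 < s → γ (τ s) ∈ Ω := by
    intro s hs hs0
    refine hin _ ⟨lt_of_le_of_ne (hτ s hs).1.1 ?_, (hτ s hs).1.2⟩
    intro h
    have := (hτ s hs).2
    rw [← h, eVariationOn.subsingleton _ (by simp)] at this
    have h2 := ENNReal.ofReal_pos.2 hs0
    rw [← this] at h2
    exact lt_irrefl _ h2
  have hsp : ∀ j : ℕ, 0 < l * q ^ j := fun j => by positivity
  have hsm : ∀ j : ℕ, l * q ^ j ∈ Icc 0 l := fun j =>
    ⟨(hsp j).le, mul_le_of_le_one_right hl0 (pow_le_one₀ hq0.le hq1.le)⟩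
  have hr : ∀ j : ℕ, 0 < lam / 2 * (l * q ^ j) := fun j => mul_pos (by positivity) (hsp j)
  refine ⟨fun j => γ (τ (l * q ^ j)), fun j => lam / 2 * (l * q ^ j), hr, ?_, ?_, ?_, ?_, ?_, ?_, ?_⟩
  · intro j
    refine ball_sub_of_frontier hΩ (hr j) (hmem _ (hsm j) (hsp j)) ?_
    have := hδ _ (hsm j)
    have := hr j
    linarith
  · have := hr 0
    simp only [pow_zero, mul_one] at this ⊢
    rw [hτl, hx1]; exact mem_ball_self this
  · have ht : Tendsto (fun j : ℕ => l * q ^ j) atTop (𝓝 0) := by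
      simpa using (tendsto_pow_atTop_nhds_zero_of_lt_one hq0.le hq1).const_mul l
    refine squeeze_zero (fun _ => infDist_nonneg) (fun j => ?_) ht
    refine (infDist_le_dist_of_mem (mem_ball_self (hr j))).trans ?_
    rw [dist_comm]; exact hτ0 _ (hsm j)
  · intro j
    refine ⟨γ (τ (l * q ^ (j+1))), ?_, mem_ball_self (hr (j+1))⟩
    have hle : l * q ^ (j+1) ≤ l * q ^ j := by
      rw [pow_succ, ← mul_assoc]; exact mul_le_of_le_one_right (hsp j).le hq1.le
    have := hd _ (hsm (j+1)) _ (hsm j) hle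
    rw [mem_ball]
    refine this.trans_lt ?_
    have h3 : l * q ^ j - l * q ^ (j+1) = lam / 4 * (l * q ^ j) := by
      rw [pow_succ, hq]; ring
    rw [h3]
    have := hr j
    linarith
  · intro j
    have hne : (frontier Ω).Nonempty := ⟨y, hy⟩
    have a1 := setDist_le_infDist hne (mem_ball_self (x := γ (τ (l * q ^ j))) (hr j))
    have a2 := hδ2 _ (hsm j)
    have a3 : lam / 2 * (l * q ^ j) ≤ setDist (ball (γ (τ (l * q ^ j))) (lam / 2 * (l * q ^ j))) (frontier Ω) := by
      refine le_setDist_ball hne (hr j) ?_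
      have := hδ _ (hsm j)
      linarith
    have hCpos : 0 < C := by linarith
    constructor
    · rw [inv_mul_le_iff₀ hCpos]
      refine (a1.trans a2).trans ?_
      calc l * q ^ j = 2 / lam * (lam / 2 * (l * q ^ j)) := by field_simp
        _ ≤ C * (lam / 2 * (l * q ^ j)) := by gcongr
    · refine a3.trans ?_
      exact le_mul_of_one_le_left ((hr j).le.trans a3) hC1
  · intro i j hij
    have : lam / 2 * (l * q ^ j) ≤ lam / 2 * (l * q ^ i) := by
      gcongr lam / 2 * (l * ?_)
      exact pow_le_pow_of_le_one hq0.le hq1.le hij.le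
    exact this.trans (le_mul_of_one_le_left (hr i).le hC1)
  · intro t ht
    set S := {j : ℕ | t < lam / 2 * (l * q ^ j) ∧ lam / 2 * (l * q ^ j) ≤ 2 * t} with hS
    rcases S.eq_empty_or_nonempty with he | hne
    · rw [he]; simp; linarith
    · have hsub : S ⊆ ↑(Finset.Ico (sInf S) (sInf S + k)) := by
        intro j hj
        have hm := Nat.sInf_mem hne
        have hmj := Nat.sInf_le hj
        simp only [Finset.coe_Ico, mem_Ico]
        refine ⟨hmj, ?_⟩
        by_contra hcon
        push Not at hcon
        have e1 : q ^ j ≤ q ^ (sInf S) * q ^ k := by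
          rw [← pow_add]; exact pow_le_pow_of_le_one hq0.le hq1.le hcon
        have e2 : q ^ (sInf S) * q ^ k ≤ q ^ (sInf S) * (1/2) := by gcongr
        have e3 : lam / 2 * (l * q ^ j) ≤ lam / 2 * (l * (q ^ (sInf S) * (1/2))) := by
          gcongr; exact e1.trans e2
        have := hm.2
        have := hj.1
        linarith
      refine ⟨(Finset.finite_toSet _).subset hsub, ?_⟩
      have := Set.ncard_le_ncard hsub (Finset.finite_toSet _)
      rw [Set.ncard_coe_finset] at this
      simp at this
      have : (S.ncard : ℝ) ≤ k := by exact_mod_cast this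
      linarith

lemma dyadic_sum {C a : ℝ} (hC : 0 < C) (ha : 0 < a) {r : ℕ → ℝ} (hr : ∀ j, 0 < r j)
    (hcount : ∀ t : ℝ, 0 < t →
      {j | t < r j ∧ r j ≤ 2 * t}.Finite ∧ ({j | t < r j ∧ r j ≤ 2 * t}.ncard : ℝ) ≤ C)
    (F : Finset ℕ) (hF : ∀ i ∈ F, r i ≤ a) : ∑ i ∈ F, r i ≤ 2 * C * a := by
  have hex : ∀ i, ∃ k : ℕ, i ∈ F → a * (1/2:ℝ) ^ (k+1) < r i ∧ r i ≤ a * (1/2:ℝ) ^ k := by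
    intro i
    by_cases hi : i ∈ F
    · obtain ⟨k, h1, h2⟩ := exists_nat_pow_near_of_lt_one (x := r i / a) (y := (1/2:ℝ))
        (div_pos (hr i) ha) ((div_le_one ha).2 (hF i hi)) (by norm_num) (by norm_num)
      rw [lt_div_iff₀' ha] at h1
      rw [div_le_iff₀' ha] at h2
      exact ⟨k, fun _ => ⟨h1, h2⟩⟩
    · exact ⟨0, fun h => absurd h hi⟩
  choose κ hκ using hex
  classical
  rw [← Finset.sum_fiberwise_of_maps_to (s := F) (t := F.image κ) (g := κ)
    (fun i hi => Finset.mem_image_of_mem _ hi)]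
  have hfib : ∀ k, ∑ i ∈ F with κ i = k, r i ≤ C * a * (1/2:ℝ)^k := by
    intro k
    have ht : 0 < a * (1/2:ℝ)^(k+1) := by positivity
    obtain ⟨hfin, hn⟩ := hcount _ ht
    have hsub : (↑(F.filter (fun i => κ i = k)) : Set ℕ) ⊆
        {j | a * (1/2:ℝ)^(k+1) < r j ∧ r j ≤ 2 * (a * (1/2:ℝ)^(k+1))} := by
      intro i hi
      simp only [Finset.coe_filter, mem_setOf_eq] at hi
      obtain ⟨hi, rfl⟩ := hi
      refine ⟨(hκ i hi).1, (hκ i hi).2.trans (le_of_eq ?_)⟩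
      rw [pow_succ]; ring
    have hcard := Set.ncard_le_ncard hsub hfin
    rw [Set.ncard_coe_finset] at hcard
    have hcard' : ((F.filter (fun i => κ i = k)).card : ℝ) ≤ C :=
      le_trans (by exact_mod_cast hcard) hn
    calc ∑ i ∈ F with κ i = k, r i ≤ ∑ i ∈ F with κ i = k, a * (1/2:ℝ)^k := by
          refine Finset.sum_le_sum fun i hi => ?_
          rw [Finset.mem_filter] at hi
          obtain ⟨hi, rfl⟩ := hi
          exact (hκ i hi).2
      _ = (F.filter (fun i => κ i = k)).card * (a * (1/2:ℝ)^k) := by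
          rw [Finset.sum_const, nsmul_eq_mul]
      _ ≤ C * (a * (1/2:ℝ)^k) := by gcongr
      _ = _ := by ring
  refine (Finset.sum_le_sum fun k _ => hfib k).trans ?_
  rw [← Finset.mul_sum]
  have := sum_le_hasSum (F.image κ) (fun i _ => by positivity) hasSum_geometric_two
  calc C * a * ∑ i ∈ F.image κ, (1/2:ℝ)^i ≤ C * a * 2 := by gcongr
    _ = _ := by ring

/-- The polygonal curve through `p j` at time `T j`. -/
lemma exists_polygon {E : Type*} [NormedAddCommGroup E] [NormedSpace ℝ E] {p : ℕ → E} {T : ℕ → ℝ}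
    {y : E} (hT : StrictAnti T) (hT0 : Tendsto T atTop (𝓝 0)) (hp : Tendsto p atTop (𝓝 y))
    (hpT : ∀ j, dist (p (j+1)) (p j) ≤ T j - T (j+1)) :
    ∃ g : ℝ → E, g 0 = y ∧ g (T 0) = p 0 ∧
      (∀ s ∈ Icc 0 (T 0), ∀ t ∈ Icc 0 (T 0), s ≤ t → dist (g s) (g t) ≤ t - s) ∧
      ∀ t ∈ Ioc 0 (T 0), ∃ j, t ≤ T j ∧ g t ∈ segment ℝ (p (j+1)) (p j) := by
  classical
  have hTpos : ∀ j, 0 < T j := fun j =>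
    lt_of_le_of_lt (hT.antitone.le_of_tendsto hT0 (j+1)) (hT (Nat.lt_succ_self j))
  have hex : ∀ t ∈ Ioc 0 (T 0), ∃ j, T (j+1) < t ∧ t ≤ T j := by
    intro t ht
    have he : ∃ j, T (j+1) < t := by
      have := (hT0.comp (tendsto_add_atTop_nat 1)).eventually (gt_mem_nhds ht.1)
      exact this.exists
    refine ⟨Nat.find he, Nat.find_spec he, ?_⟩
    rcases h : Nat.find he with _ | m
    · exact ht.2
    · have := Nat.find_min he (m := m) (by omega)
      exact not_lt.1 this
  choose! J hJ1 hJ2 using hex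
  have hpd : ∀ a b, a ≤ b → dist (p b) (p a) ≤ T a - T b := by
    intro a b hab
    induction b, hab using Nat.le_induction with
    | base => simp
    | succ b hab ih =>
      have := hpT b
      have := dist_triangle (p (b+1)) (p b) (p a)
      linarith
  have hpy : ∀ a, dist y (p a) ≤ T a := by
    intro a
    have h1 : Tendsto (fun b => dist (p b) (p a)) atTop (𝓝 (dist y (p a))) :=
      hp.dist tendsto_const_nhds
    refine le_of_tendsto h1 ?_
    filter_upwards [eventually_ge_atTop a] with b hb
    have := hpd a b hb
    have := hTpos b
    linarith
  set θ : ℝ → ℝ := fun t => (t - T (J t + 1)) / (T (J t) - T (J t + 1)) with hθ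
  set g : ℝ → E := fun t => if t = 0 then y else AffineMap.lineMap (p (J t + 1)) (p (J t)) (θ t)
    with hg
  have hgt : ∀ t ∈ Ioc 0 (T 0), g t = AffineMap.lineMap (p (J t + 1)) (p (J t)) (θ t) := by
    intro t ht
    simp only [hg, if_neg ht.1.ne']
  have hTd : ∀ j, 0 < T j - T (j+1) := fun j => sub_pos.2 (hT (Nat.lt_succ_self j))
  have hθm : ∀ t ∈ Ioc 0 (T 0), θ t ∈ Icc (0:ℝ) 1 := by
    intro t ht
    have := hJ1 t ht
    have := hJ2 t ht
    refine ⟨div_nonneg (by linarith) (hTd _).le, (div_le_one (hTd _)).2 (by linarith)⟩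
  have hleft : ∀ t ∈ Ioc 0 (T 0), dist (g t) (p (J t + 1)) ≤ t - T (J t + 1) := by
    intro t ht
    rw [hgt t ht, dist_lineMap_left, Real.norm_of_nonneg (hθm t ht).1]
    calc θ t * dist (p (J t + 1)) (p (J t)) ≤ θ t * (T (J t) - T (J t + 1)) :=
          mul_le_mul_of_nonneg_left (hpT _) (hθm t ht).1
      _ = _ := div_mul_cancel₀ _ (hTd _).ne'
  have hright : ∀ t ∈ Ioc 0 (T 0), dist (g t) (p (J t)) ≤ T (J t) - t := by
    intro t ht
    rw [hgt t ht, dist_lineMap_right, Real.norm_of_nonneg (sub_nonneg.2 (hθm t ht).2)]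
    calc (1 - θ t) * dist (p (J t + 1)) (p (J t)) ≤ (1 - θ t) * (T (J t) - T (J t + 1)) :=
          mul_le_mul_of_nonneg_left (hpT _) (sub_nonneg.2 (hθm t ht).2)
      _ = (T (J t) - T (J t + 1)) - θ t * (T (J t) - T (J t + 1)) := by ring
      _ = (T (J t) - T (J t + 1)) - (t - T (J t + 1)) := by
          rw [hθ]; dsimp only; rw [div_mul_cancel₀ _ (hTd _).ne']
      _ = _ := by ring
  have h0m : T 0 ∈ Ioc 0 (T 0) := ⟨hTpos 0, le_rfl⟩
  have hJ0 : J (T 0) = 0 := by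
    by_contra h
    have := hJ2 _ h0m
    have := hT (Nat.pos_of_ne_zero h)
    linarith
  refine ⟨g, by simp [hg], ?_, ?_, ?_⟩
  · have := hright _ h0m
    rw [hJ0, sub_self] at this
    exact dist_le_zero.1 this
  · intro s hs t ht hst
    rcases eq_or_lt_of_le hs.1 with h0 | h0
    · subst h0
      rcases eq_or_lt_of_le ht.1 with h0 | h0
      · subst h0; simp
      · have h1 := hleft t ⟨h0, ht.2⟩
        have h2 := hpy (J t + 1)
        have h3 := dist_triangle_right y (g t) (p (J t + 1))
        have h4 : g 0 = y := by simp [hg]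
        rw [h4]
        linarith
    · have hs' : s ∈ Ioc 0 (T 0) := ⟨h0, hs.2⟩
      have ht' : t ∈ Ioc 0 (T 0) := ⟨h0.trans_le hst, ht.2⟩
      rcases lt_trichotomy (J s) (J t) with h | h | h
      · exfalso
        have := hT.antitone (show J s + 1 ≤ J t from h)
        have := hJ1 s hs'
        have := hJ2 t ht'
        linarith
      · rw [hgt s hs', hgt t ht', ← h, dist_lineMap_lineMap, dist_comm (θ s), Real.dist_eq]
        have e : θ t - θ s = (t - s) / (T (J s) - T (J s + 1)) := by
          simp only [hθ, ← h]; ring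
        rw [e, abs_of_nonneg (div_nonneg (by linarith) (hTd _).le)]
        calc _ ≤ (t - s) / (T (J s) - T (J s + 1)) * (T (J s) - T (J s + 1)) :=
              mul_le_mul_of_nonneg_left (hpT _) (div_nonneg (by linarith) (hTd _).le)
          _ = _ := div_mul_cancel₀ _ (hTd _).ne'
      · have h1 := hright s hs'
        have h2 := hleft t ht'
        have h3 := hpd (J t + 1) (J s) h
        have h4 := dist_triangle4 (g s) (p (J s)) (p (J t + 1)) (g t)
        rw [dist_comm (p (J t + 1)) (g t)] at h4
        linarith
  · intro t ht
    refine ⟨J t, hJ2 t ht, ?_⟩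
    rw [hgt t ht, segment_eq_image_lineMap]
    exact ⟨_, hθm t ht, rfl⟩

lemma backward (n : ℕ) (C : ℝ) (hC : 0 < C) : ∃ lam : ℝ, 0 < lam ∧ lam < 1 ∧
      ∀ (Ω : Set (EuclideanSpace ℝ (Fin (n+1)))) (x y : EuclideanSpace ℝ (Fin (n+1))),
        IsOpen Ω → x ∈ Ω → y ∈ frontier Ω →
        (∃ c r, IsGoodChain Ω C c r x y) →
        ∃ γ, IsCarrotPath Ω lam γ y x := by
  set D := 4 * C * (C + 1) * C + 1 with hD
  have hD1 : 1 < D := by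
    have : 0 < 4 * C * (C + 1) * C := by positivity
    linarith
  have hD0 : 0 < D := by linarith
  refine ⟨D⁻¹, by positivity, inv_lt_one_of_one_lt₀ hD1, ?_⟩
  rintro Ω x y hΩ hx hy ⟨c, r, hr, hB, hxB, hyB, hint, hcomp, hmono, hcount⟩
  choose w hw using hint
  -- sums
  have hsum : ∀ j, ∀ F : Finset ℕ, ∑ i ∈ F, r (i + j) ≤ 2 * C * ((C + 1) * r j) := by
    intro j F
    have := dyadic_sum hC (show 0 < (C+1) * r j from mul_pos (by linarith) (hr j)) hr hcount
      (F.map (addRightEmbedding j)) (by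
        intro i hi
        simp only [Finset.mem_map, addRightEmbedding_apply] at hi
        obtain ⟨m, _, rfl⟩ := hi
        have := hr j
        rcases Nat.eq_zero_or_pos m with rfl | hm
        · rw [zero_add]; nlinarith
        · have := hmono j (m + j) (by omega)
          nlinarith)
    simpa using this
  have hsumm : ∀ j, Summable (fun i => r (i + j)) := fun j =>
    summable_of_sum_le (fun i => (hr _).le) (hsum j)
  have hts : ∀ j, ∑' i, r (i + j) ≤ 2 * C * ((C + 1) * r j) := fun j =>
    (hsumm j).tsum_le_of_sum_le (hsum j)
  set T : ℕ → ℝ := fun j => 2 * ∑' i, r (i + j) with hTdef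
  have hTs : ∀ j, T j - T (j+1) = 2 * r j := by
    intro j
    simp only [hTdef]
    rw [(hsumm j).tsum_eq_zero_add, zero_add]
    simp only [add_assoc, add_comm 1 j]
    ring
  have hTanti : StrictAnti T := strictAnti_nat_of_succ_lt fun j => by
    have := hTs j
    have := hr j
    linarith
  have hT0 : Tendsto T atTop (𝓝 0) := by
    simpa using (tendsto_sum_nat_add r).const_mul 2
  have hTpos : 0 < T 0 := lt_of_le_of_lt (hTanti.antitone.le_of_tendsto hT0 1) (hTanti zero_lt_one)
  have hr0 : Tendsto r atTop (𝓝 0) := by simpa using (hsumm 0).tendsto_atTop_zero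
  set p : ℕ → EuclideanSpace ℝ (Fin (n+1)) := fun j => Nat.casesOn j x w with hpdef
  have hp1 : ∀ j, p j ∈ ball (c j) (r j) := by
    intro j
    cases j with
    | zero => exact hxB
    | succ j => exact (hw j).2
  have hp2 : ∀ j, p (j+1) ∈ ball (c j) (r j) := fun j => (hw j).1
  have hpT : ∀ j, dist (p (j+1)) (p j) ≤ T j - T (j+1) := by
    intro j
    rw [hTs]
    have h1 := mem_ball.1 (hp1 j)
    have h2 := mem_ball.1 (hp2 j)
    have := dist_triangle_right (p (j+1)) (p j) (c j)
    linarith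
  have hp : Tendsto p atTop (𝓝 y) := by
    rw [tendsto_iff_dist_tendsto_zero]
    have hlim : Tendsto (fun j => infDist y (ball (c j) (r j)) + 2 * r j) atTop (𝓝 0) := by
      simpa using hyB.add (hr0.const_mul 2)
    refine squeeze_zero (fun _ => dist_nonneg) (fun j => ?_) hlim
    have : dist (p j) y - 2 * r j ≤ infDist y (ball (c j) (r j)) := by
      rw [le_infDist ⟨_, hp1 j⟩]
      intro z hz
      have h1 := mem_ball.1 (hp1 j)
      have h2 := mem_ball.1 hz
      have h3 := dist_triangle_right (p j) z (c j)
      have h4 := dist_triangle (p j) z y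
      rw [dist_comm z y] at h4
      linarith
    linarith
  obtain ⟨g, hg0, hg1, hglip, hgseg⟩ := exists_polygon hTanti hT0 hp hpT
  have hgB : ∀ t ∈ Ioc 0 (T 0), ∃ j, t ≤ T j ∧ g t ∈ ball (c j) (r j) := by
    intro t ht
    obtain ⟨j, h1, h2⟩ := hgseg t ht
    exact ⟨j, h1, (convex_ball _ _).segment_subset (hp2 j) (hp1 j) h2⟩
  have hscale : ∀ t ∈ Icc (0:ℝ) 1, T 0 * t ∈ Icc 0 (T 0) := fun t ht =>
    ⟨mul_nonneg hTpos.le ht.1, mul_le_of_le_one_right hTpos.le ht.2⟩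
  have hscale' : ∀ t ∈ Ioc (0:ℝ) 1, T 0 * t ∈ Ioc 0 (T 0) := fun t ht =>
    ⟨mul_pos hTpos ht.1, mul_le_of_le_one_right hTpos.le ht.2⟩
  have hlip : LipschitzOnWith (T 0).toNNReal (fun t => g (T 0 * t)) (Icc 0 1) := by
    refine LipschitzOnWith.of_dist_le_mul ?_
    intro s hs t ht
    rw [Real.coe_toNNReal _ hTpos.le]
    rcases le_total s t with h | h
    · refine (hglip _ (hscale s hs) _ (hscale t ht) (by gcongr)).trans (le_of_eq ?_)
      rw [dist_comm, Real.dist_eq, abs_of_nonneg (by linarith)]; ring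
    · rw [dist_comm]
      refine (hglip _ (hscale t ht) _ (hscale s hs) (by gcongr)).trans (le_of_eq ?_)
      rw [Real.dist_eq, abs_of_nonneg (by linarith)]; ring
  have hvar : ∀ t ∈ Icc (0:ℝ) 1, eVariationOn (fun t => g (T 0 * t)) (Icc (0:ℝ) t) ≤
      ENNReal.ofReal (T 0 * t) := by
    intro t ht
    have h1 := hlip.comp_eVariationOn_le (g := id) (s := Icc (0:ℝ) t)
      (fun u hu => ⟨hu.1, hu.2.trans ht.2⟩)
    have h2 : eVariationOn (id : ℝ → ℝ) (Icc (0:ℝ) t) ≤ ENNReal.ofReal t := by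
      have := (monotone_id.monotoneOn (Icc (0:ℝ) t)).eVariationOn_le (a := 0) (b := t)
        ⟨le_rfl, ht.1⟩ ⟨ht.1, le_rfl⟩
      simpa using this
    rw [ENNReal.ofReal_mul hTpos.le]
    exact h1.trans (mul_le_mul_right h2 _)
  refine ⟨fun t => g (T 0 * t), hlip.continuousOn, by simpa using hg0, by simp only [mul_one]; exact hg1,
    ?_, ?_, ?_⟩
  · intro t ht
    obtain ⟨j, _, h⟩ := hgB _ (hscale' t ht)
    exact hB j h
  · exact ne_top_of_le_ne_top ENNReal.ofReal_ne_top (hvar 1 (by simp))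
  · intro t ht
    refine (mul_le_mul_right (hvar t ht) _).trans ?_
    rw [← ENNReal.ofReal_mul (by positivity)]
    refine ENNReal.ofReal_le_ofReal ?_
    rcases eq_or_lt_of_le ht.1 with h0 | h0
    · rw [← h0]; simp [infDist_nonneg]
    obtain ⟨j, h1, h2⟩ := hgB _ (hscale' t ⟨h0, ht.2⟩)
    rw [inv_mul_le_iff₀ hD0]
    have h3 := setDist_le_infDist ⟨y, hy⟩ h2
    have h4 := (hcomp j).2
    have h5 : r j ≤ C * infDist (g (T 0 * t)) (frontier Ω) := h4.trans (by gcongr)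
    have h6 := hts j
    calc T 0 * t ≤ T j := h1
      _ ≤ 4 * C * (C + 1) * r j := by simp only [hTdef]; linarith
      _ ≤ 4 * C * (C + 1) * (C * infDist (g (T 0 * t)) (frontier Ω)) := by gcongr
      _ ≤ D * infDist (g (T 0 * t)) (frontier Ω) := by
        rw [hD]
        have := infDist_nonneg (x := g (T 0 * t)) (s := frontier Ω)
        linarith

/-- Lemma: carrot curves ⟺ good Harnack chains.
For an open set `Ω ⊂ ℝ^{n+1}`, `x ∈ Ω`, `y ∈ ∂Ω`: the existence of a `lam`-carrot path from `y`
to `x` implies the existence of a `C`-good Harnack chain from `x` to `y`, with `C = C(lam)`; and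
conversely the existence of a `C`-good Harnack chain from `x` to `y` implies the existence of a
`lam'`-carrot path from `y` to `x`, with `lam' = lam'(C)`. -/
theorem carrot_path_iff_good_harnack_chain (n : ℕ) :
    (∀ lam : ℝ, 0 < lam → lam < 1 → ∃ C : ℝ, 0 < C ∧
      ∀ (Ω : Set (EuclideanSpace ℝ (Fin (n+1)))) (x y : EuclideanSpace ℝ (Fin (n+1))),
        IsOpen Ω → x ∈ Ω → y ∈ frontier Ω →
        (∃ γ, IsCarrotPath Ω lam γ y x) →
        ∃ c r, IsGoodChain Ω C c r x y) ∧
    (∀ C : ℝ, 0 < C → ∃ lam : ℝ, 0 < lam ∧ lam < 1 ∧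
      ∀ (Ω : Set (EuclideanSpace ℝ (Fin (n+1)))) (x y : EuclideanSpace ℝ (Fin (n+1))),
        IsOpen Ω → x ∈ Ω → y ∈ frontier Ω →
        (∃ c r, IsGoodChain Ω C c r x y) →
        ∃ γ, IsCarrotPath Ω lam γ y x) := by
  exact ⟨forward n, backward n⟩
end
end

section
/- Let Ω ⊊ ℝ^{n+1} be an open set whose boundary ∂Ω is n-ADR. Then for every x ∈ ∂Ω and 0 < r ≤ diam(∂Ω)/2, harmonic measure satisfies ω^y(B(x,2r)) ≥ c > 0 for all y ∈ Ω ∩ closure(B(x,r)), where c depends only on n and the ADR constant of ∂Ω. -/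
open Set Metric MeasureTheory Filter Topology
open scoped ENNReal

noncomputable section

/-- `E ⊂ ℝ^{n+1}` is `n`-Ahlfors–David regular with constant `C`:
`E` is closed and `C⁻¹ rⁿ ≤ Hⁿ(E ∩ B(x,r)) ≤ C rⁿ` for `x ∈ E`, `0 < r < diam E`. -/
def IsADR (n : ℕ) (E : Set (EuclideanSpace ℝ (Fin (n+1)))) (C : ℝ) : Prop :=
  IsClosed E ∧ 1 ≤ C ∧
  ∀ x ∈ E, ∀ r : ℝ, 0 < r → ENNReal.ofReal r < EMetric.diam E →
    ENNReal.ofReal (C⁻¹ * r ^ n) ≤ (Measure.hausdorffMeasure (n:ℝ)).restrict E (ball x r) ∧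
    (Measure.hausdorffMeasure (n:ℝ)).restrict E (ball x r) ≤ ENNReal.ofReal (C * r ^ n)

/-- Surface measure `σ = Hⁿ⌊E`. -/
def surf (n : ℕ) (E : Set (EuclideanSpace ℝ (Fin (n+1)))) :
    Measure (EuclideanSpace ℝ (Fin (n+1))) :=
  (Measure.hausdorffMeasure (n:ℝ)).restrict E

/-- `u` is harmonic on `s`: twice continuously differentiable with vanishing Laplacian. -/
def HarmonicOn {n : ℕ} (u : EuclideanSpace ℝ (Fin (n+1)) → ℝ)
    (s : Set (EuclideanSpace ℝ (Fin (n+1)))) : Prop :=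
  ContDiffOn ℝ 2 u s ∧
  ∀ x ∈ s, ∑ i : Fin (n+1),
    fderiv ℝ (fun y => fderiv ℝ u y (EuclideanSpace.single i 1)) x
      (EuclideanSpace.single i 1) = 0

/-- `ω` is the harmonic measure family of the open set `Ω`: each `ω p` (for `p ∈ Ω`) is a
probability measure supported on `∂Ω`, and for every bounded continuous boundary datum `g`,
the function `p ↦ ∫ g dω^p` is harmonic in `Ω` and attains the datum continuously
at every boundary point. -/
def IsHarmonicMeasure {n : ℕ} (Ω : Set (EuclideanSpace ℝ (Fin (n+1))))
    (ω : EuclideanSpace ℝ (Fin (n+1)) → Measure (EuclideanSpace ℝ (Fin (n+1)))) : Prop :=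
  (∀ p ∈ Ω, IsProbabilityMeasure (ω p)) ∧
  (∀ p ∈ Ω, ω p (frontier Ω)ᶜ = 0) ∧
  ∀ g : EuclideanSpace ℝ (Fin (n+1)) → ℝ, Continuous g → (∃ M, ∀ x, |g x| ≤ M) →
    HarmonicOn (fun p => ∫ x, g x ∂(ω p)) Ω ∧
    ∀ ξ ∈ frontier Ω, Tendsto (fun p => ∫ x, g x ∂(ω p)) (nhdsWithin ξ Ω) (nhds (g ξ))

lemma sd_u {n : ℕ} {u : EuclideanSpace ℝ (Fin (n+1)) → ℝ} {Ω : Set (EuclideanSpace ℝ (Fin (n+1)))}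
    (hΩ : IsOpen Ω) (hu : HarmonicOn u Ω) {p : EuclideanSpace ℝ (Fin (n+1))} (hp : p ∈ Ω)
    {ε : ℝ} (hε : 0 < ε) :
    ∀ᶠ t : ℝ in 𝓝[>] 0, ∑ i : Fin (n+1), (u (p + t • EuclideanSpace.single i (1:ℝ))
      + u (p - t • EuclideanSpace.single i (1:ℝ)) - 2 * u p) ≤ ε * t ^ 2 := by
  obtain ⟨hC, hL⟩ := hu
  have hd : ∀ q ∈ Ω, DifferentiableAt ℝ u q := fun q hq =>
    ((hC.contDiffAt (hΩ.mem_nhds hq)).differentiableAt (by norm_num))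
  have hdd : DifferentiableAt ℝ (fderiv ℝ u) p :=
    ((hC.contDiffAt (hΩ.mem_nhds hp)).fderiv_right (m := 1) (by norm_num)).differentiableAt
      (by norm_num)
  -- derivative of the sum of first differences
  set e : Fin (n+1) → EuclideanSpace ℝ (Fin (n+1)) := fun i => EuclideanSpace.single i (1:ℝ)
    with he
  have hne : ∀ i, ‖e i‖ = 1 := by intro i; simp [he]
  let D : ℝ → ℝ := fun t => ∑ i, (fderiv ℝ u (p + t • e i) (e i) - fderiv ℝ u (p - t • e i) (e i))
  have hD : HasDerivAt D 0 0 := by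
    have h1 : ∀ i ∈ Finset.univ, HasDerivAt (fun t : ℝ => fderiv ℝ u (p + t • e i) (e i)
        - fderiv ℝ u (p - t • e i) (e i))
        (fderiv ℝ (fun y => fderiv ℝ u y (e i)) p (e i)
          - fderiv ℝ (fun y => fderiv ℝ u y (e i)) p (-e i)) 0 := by
      intro i _
      have hf : HasFDerivAt (fun y => fderiv ℝ u y (e i))
          (fderiv ℝ (fun y => fderiv ℝ u y (e i)) p) p :=
        (hdd.clm_apply (differentiableAt_const _)).hasFDerivAt
      refine HasDerivAt.sub ?_ ?_
      · have hg : HasDerivAt (fun t : ℝ => p + t • e i) (e i) 0 := by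
          simpa using ((hasDerivAt_id (0:ℝ)).smul_const (e i)).const_add p
        exact HasFDerivAt.comp_hasDerivAt (0:ℝ) (by simpa using hf) hg
      · have hg : HasDerivAt (fun t : ℝ => p - t • e i) (-e i) 0 := by
          simpa using ((hasDerivAt_id (0:ℝ)).smul_const (e i)).const_sub p
        exact HasFDerivAt.comp_hasDerivAt (0:ℝ) (by simpa using hf) hg
    have h2 := HasDerivAt.fun_sum h1
    have h3 : ∑ i, (fderiv ℝ (fun y => fderiv ℝ u y (e i)) p (e i)
          - fderiv ℝ (fun y => fderiv ℝ u y (e i)) p (-e i)) = 0 := by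
      simp only [map_neg, sub_neg_eq_add, Finset.sum_add_distrib]
      have := hL p hp
      simp only [he]; rw [this]; simp
    rw [h3] at h2
    exact h2
  have hD0 : D 0 = 0 := by simp [D]
  have hsmall : ∀ᶠ t : ℝ in 𝓝 0, |D t| ≤ ε * |t| := by
    have := (hasDerivAt_iff_isLittleO_nhds_zero.1 hD).bound hε
    filter_upwards [this] with t ht
    simpa [hD0] using ht
  obtain ⟨δ, hδ, hball⟩ := Metric.isOpen_iff.1 hΩ p hp
  obtain ⟨δ', hδ', hs⟩ := Metric.eventually_nhds_iff.1 hsmall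
  have hev : ∀ᶠ t : ℝ in 𝓝[>] 0, t ∈ Ioo 0 (min δ δ') :=
    Ioo_mem_nhdsGT (lt_min hδ hδ')
  filter_upwards [hev] with t ht
  have ht0 := ht.1
  have htδ : t < δ := ht.2.trans_le (min_le_left _ _)
  have htδ' : t < δ' := ht.2.trans_le (min_le_right _ _)
  let Ψ : ℝ → ℝ := fun t => ∑ i, (u (p + t • e i) + u (p - t • e i) - 2 * u p)
  have hder : ∀ s ∈ Icc 0 t, HasDerivAt Ψ (D s) s := by
    intro s hs
    refine HasDerivAt.fun_sum (fun i _ => ?_)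
    have hsn : |s| < δ := by rw [abs_of_nonneg hs.1]; exact hs.2.trans_lt htδ
    have m1 : p + s • e i ∈ Ω := hball (by simp [norm_smul, hne, hsn])
    have m2 : p - s • e i ∈ Ω := hball (by simp [norm_smul, hne, hsn])
    have hg1 : HasDerivAt (fun t : ℝ => p + t • e i) (e i) s := by
      simpa using ((hasDerivAt_id s).smul_const (e i)).const_add p
    have hg2 : HasDerivAt (fun t : ℝ => p - t • e i) (-e i) s := by
      simpa using ((hasDerivAt_id s).smul_const (e i)).const_sub p
    have a1 := (hd _ m1).hasFDerivAt.comp_hasDerivAt s hg1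
    have a2 := (hd _ m2).hasFDerivAt.comp_hasDerivAt s hg2
    have := (a1.add a2).sub_const (2 * u p)
    simpa [sub_eq_add_neg] using this
  have hmv := (convex_Icc (0:ℝ) t).norm_image_sub_le_of_norm_hasDerivWithin_le
    (f := Ψ) (f' := D) (C := ε * t) (fun s hs => (hder s hs).hasDerivWithinAt)
    (fun s hs' => by
      have : |D s| ≤ ε * |s| := hs (by simp [abs_of_nonneg hs'.1]; exact hs'.2.trans_lt htδ')
      rw [Real.norm_eq_abs]
      refine this.trans ?_
      rw [abs_of_nonneg hs'.1]
      exact mul_le_mul_of_nonneg_left hs'.2 hε.le)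
    (left_mem_Icc.2 ht0.le) (right_mem_Icc.2 ht0.le)
  have hΨ0 : Ψ 0 = 0 := by
    simp only [Ψ]; refine Finset.sum_eq_zero (fun i _ => ?_); simp; ring
  rw [hΨ0, sub_zero, sub_zero, Real.norm_eq_abs, Real.norm_eq_abs, abs_of_pos ht0] at hmv
  calc _ = Ψ t := rfl
    _ ≤ |Ψ t| := le_abs_self _
    _ ≤ ε * t * t := hmv
    _ = _ := by ring

lemma comparison {n : ℕ} {u w : EuclideanSpace ℝ (Fin (n+1)) → ℝ}
    {Ω : Set (EuclideanSpace ℝ (Fin (n+1)))} {x : EuclideanSpace ℝ (Fin (n+1))} {R : ℝ}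
    (hΩ : IsOpen Ω) (hu : HarmonicOn u Ω) (hu0 : ∀ p ∈ Ω, 0 ≤ u p)
    (hlim : ∀ ξ ∈ frontier Ω, ξ ∈ closedBall x R → Tendsto u (𝓝[Ω] ξ) (𝓝 1))
    (hw1 : ∀ p ∈ Ω, w p ≤ 1) (hwc : ContinuousOn w Ω)
    (hws : ∀ p ∈ Ω, dist p x = R → w p ≤ 0)
    (hsub : ∀ p ∈ Ω, p ∈ ball x R → ∃ c : ℝ, 0 < c ∧ ∀ᶠ t : ℝ in 𝓝[>] 0,
      c * t ^ 2 ≤ ∑ i : Fin (n+1), (w (p + t • EuclideanSpace.single i (1:ℝ))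
      + w (p - t • EuclideanSpace.single i (1:ℝ)) - 2 * w p)) :
    ∀ y ∈ Ω, y ∈ closedBall x R → w y ≤ u y := by
  classical
  intro y hy hyR
  by_contra hcon
  push Not at hcon
  let F : EuclideanSpace ℝ (Fin (n+1)) → ℝ := fun p => if p ∈ Ω then max (w p - u p) 0 else 0
  have hFΩ : ∀ p ∈ Ω, F p = max (w p - u p) 0 := fun p hp => by simp [F, hp]
  have hFn : ∀ p, p ∉ Ω → F p = 0 := fun p hp => by simp [F, hp]
  have huc : ContinuousOn u Ω := hu.1.continuousOn
  have hFc : ContinuousOn F (closedBall x R) := by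
    intro p hp
    refine ContinuousAt.continuousWithinAt ?_
    by_cases hpΩ : p ∈ Ω
    · have hn := hΩ.mem_nhds hpΩ
      have : ContinuousAt (fun p => max (w p - u p) 0) p :=
        ((hwc.continuousAt hn).sub (huc.continuousAt hn)).max continuousAt_const
      refine this.congr ?_
      filter_upwards [hn] with q hq using (hFΩ q hq).symm
    · by_cases hpc : p ∈ closure Ω
      · have hfr : p ∈ frontier Ω := by
          rw [hΩ.frontier_eq]; exact ⟨hpc, hpΩ⟩
        have hl := hlim p hfr hp
        rw [ContinuousAt, hFn p hpΩ, Metric.tendsto_nhds]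
        intro ε hε
        have h1 : ∀ᶠ q in 𝓝[Ω] p, 1 - ε < u q := hl.eventually (lt_mem_nhds (by linarith))
        rw [eventually_nhdsWithin_iff] at h1
        filter_upwards [h1] with q hq
        by_cases hqΩ : q ∈ Ω
        · have := hq hqΩ
          rw [hFΩ q hqΩ, Real.dist_eq, sub_zero, abs_of_nonneg (le_max_right _ _)]
          exact max_lt (by have := hw1 q hqΩ; linarith) hε
        · rw [hFn q hqΩ]; simpa using hε
      · have : F =ᶠ[𝓝 p] fun _ => (0:ℝ) := by
          filter_upwards [isClosed_closure.isOpen_compl.mem_nhds hpc] with q hq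
          exact hFn q (fun h => hq (subset_closure h))
        exact continuousAt_const.congr this.symm
  obtain ⟨p, hpB, hpmax⟩ := (isCompact_closedBall x R).exists_isMaxOn ⟨y, hyR⟩ hFc
  have hFy : 0 < F y := by rw [hFΩ y hy]; exact lt_max_of_lt_left (by linarith)
  have hFp : 0 < F p := hFy.trans_le (hpmax hyR)
  have hpΩ : p ∈ Ω := by by_contra h; rw [hFn p h] at hFp; exact lt_irrefl _ hFp
  have hfp : 0 < w p - u p := by
    rw [hFΩ p hpΩ] at hFp
    rcases lt_max_iff.1 hFp with h | h
    · exact h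
    · exact absurd h (lt_irrefl _)
  have hFpe : F p = w p - u p := by rw [hFΩ p hpΩ]; exact max_eq_left hfp.le
  have hpball : p ∈ ball x R := by
    rcases (mem_closedBall.1 hpB).lt_or_eq with h | h
    · exact h
    · have := hws p hpΩ h; have := hu0 p hpΩ; linarith
  obtain ⟨c, hc, hev⟩ := hsub p hpΩ hpball
  have hsu := sd_u hΩ hu hpΩ (half_pos hc)
  obtain ⟨δ, hδ, hball⟩ := Metric.isOpen_iff.1 (hΩ.inter isOpen_ball) p ⟨hpΩ, hpball⟩
  have hI : ∀ᶠ t : ℝ in 𝓝[>] 0, t ∈ Ioo 0 δ := Ioo_mem_nhdsGT hδ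
  obtain ⟨t, h1, h2, ht⟩ := (hev.and (hsu.and hI)).exists
  have hle : ∀ q ∈ ball p δ, w q - u q ≤ w p - u p := by
    intro q hq
    obtain ⟨a, b⟩ := hball hq
    rw [← hFpe]
    refine le_trans ?_ (hpmax (ball_subset_closedBall b))
    simp only [hFΩ q a]; exact le_max_left _ _
  have h3 : ∑ i : Fin (n+1), (w (p + t • EuclideanSpace.single i (1:ℝ))
      + w (p - t • EuclideanSpace.single i (1:ℝ)) - 2 * w p) ≤
      ∑ i : Fin (n+1), (u (p + t • EuclideanSpace.single i (1:ℝ))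
      + u (p - t • EuclideanSpace.single i (1:ℝ)) - 2 * u p) := by
    refine Finset.sum_le_sum (fun i _ => ?_)
    have e1 := hle (p + t • EuclideanSpace.single i (1:ℝ))
      (by simp [norm_smul, abs_of_pos ht.1, ht.2])
    have e2 := hle (p - t • EuclideanSpace.single i (1:ℝ))
      (by simp [norm_smul, abs_of_pos ht.1, ht.2])
    linarith
  have : 0 < c * t ^ 2 := mul_pos hc (pow_pos ht.1 2)
  linarith

lemma reduction {n : ℕ} {w : EuclideanSpace ℝ (Fin (n+1)) → ℝ}
    {Ω : Set (EuclideanSpace ℝ (Fin (n+1)))} {x : EuclideanSpace ℝ (Fin (n+1))} {r c : ℝ}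
    {ω : EuclideanSpace ℝ (Fin (n+1)) → Measure (EuclideanSpace ℝ (Fin (n+1)))}
    (hr : 0 < r)
    (hΩ : IsOpen Ω) (hω : IsHarmonicMeasure Ω ω)
    (hw1 : ∀ p ∈ Ω, w p ≤ 1) (hwc : ContinuousOn w Ω)
    (hws : ∀ p ∈ Ω, dist p x = 7 / 4 * r → w p ≤ 0)
    (hsub : ∀ p ∈ Ω, p ∈ ball x (7 / 4 * r) → ∃ c : ℝ, 0 < c ∧ ∀ᶠ t : ℝ in 𝓝[>] 0,
      c * t ^ 2 ≤ ∑ i : Fin (n+1), (w (p + t • EuclideanSpace.single i (1:ℝ))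
      + w (p - t • EuclideanSpace.single i (1:ℝ)) - 2 * w p))
    (hwy : ∀ y ∈ Ω, y ∈ closedBall x r → c ≤ w y) :
    ∀ y ∈ Ω ∩ closedBall x r, ENNReal.ofReal c ≤ ω y (ball x (2 * r)) := by
  rintro y ⟨hy, hyr⟩
  obtain ⟨hP, -, hH⟩ := hω
  let g : EuclideanSpace ℝ (Fin (n+1)) → ℝ := fun z => max 0 (min 1 ((2 * r - dist z x) / (r / 4)))
  have hgc : Continuous g := by
    simp only [g]; fun_prop
  have hg0 : ∀ z, 0 ≤ g z := fun z => le_max_left _ _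
  have hg1 : ∀ z, g z ≤ 1 := fun z => max_le zero_le_one (min_le_left _ _)
  have hgi : ∀ z ∈ closedBall x (7 / 4 * r), g z = 1 := by
    intro z hz
    have hz' : dist z x ≤ 7 / 4 * r := hz
    have : 1 ≤ (2 * r - dist z x) / (r / 4) := by rw [le_div_iff₀ (by positivity)]; linarith
    simp [g, min_eq_left this]
  have hgo : ∀ z, z ∉ ball x (2 * r) → g z = 0 := by
    intro z hz
    have hz' : 2 * r ≤ dist z x := by simpa using hz
    have : (2 * r - dist z x) / (r / 4) ≤ 0 := div_nonpos_of_nonpos_of_nonneg (by linarith) (by positivity)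
    exact max_eq_left ((min_le_right _ _).trans this)
  obtain ⟨hharm, hbd⟩ := hH g hgc ⟨1, fun z => by rw [abs_of_nonneg (hg0 z)]; exact hg1 z⟩
  have key := comparison (R := 7 / 4 * r) hΩ hharm (fun p _ => integral_nonneg hg0)
    (fun ξ hξ hξB => by have := hbd ξ hξ; rwa [hgi ξ hξB] at this) hw1 hwc hws hsub y hy
    (closedBall_subset_closedBall (by linarith) hyr)
  have h1 := (hwy y hy hyr).trans key
  have := hP y hy
  have h2 : ∫ z, g z ∂(ω y) ≤ (ω y).real (ball x (2 * r)) := by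
    rw [← integral_indicator_one measurableSet_ball]
    refine integral_mono_of_nonneg (Eventually.of_forall hg0) ?_ (Eventually.of_forall ?_)
    · exact (integrable_const (1:ℝ)).indicator measurableSet_ball
    · intro z
      by_cases hz : z ∈ ball x (2 * r)
      · simp only [indicator_of_mem hz]; exact hg1 z
      · simp only [indicator_of_notMem hz]; exact (hgo z hz).le
  refine (ENNReal.ofReal_le_ofReal (h1.trans h2)).trans ?_
  rw [ofReal_measureReal]

lemma cosh_lb (y : ℝ) : 1 + y ^ 2 / 2 ≤ Real.cosh y := by
  have h : Real.cosh y = 1 + 2 * Real.sinh (|y| / 2) ^ 2 := by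
    rw [← Real.cosh_abs y]
    conv_lhs => rw [show |y| = 2 * (|y| / 2) by ring, Real.cosh_two_mul, Real.cosh_sq]
    ring
  have h2 : |y| / 2 ≤ Real.sinh (|y| / 2) := Real.self_le_sinh_iff.2 (by positivity)
  have h3 : (|y| / 2) ^ 2 ≤ Real.sinh (|y| / 2) ^ 2 := pow_le_pow_left₀ (by positivity) h2 2
  rw [h, ← sq_abs y]; nlinarith

lemma log_lb {x : ℝ} (hx0 : 0 ≤ x) (hx : x < 1) : 2 * x ≤ Real.log (1 + x) - Real.log (1 - x) := by
  have h := Real.hasSum_log_sub_log_of_abs_lt_one (x := x) (by rwa [abs_of_nonneg hx0])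
  have := sum_le_hasSum {0} (fun i _ => by positivity) h
  simpa using this

lemma kern0 {q x : ℝ} (hq : 0 ≤ q) (hx0 : 0 ≤ x) (hx : x < 1) :
    2 + q * (q + 1) * x ^ 2 ≤ (1 + x) ^ (-q) + (1 - x) ^ (-q) := by
  have p1 : 0 < 1 + x := by linarith
  have p2 : 0 < 1 - x := by linarith
  rw [Real.rpow_def_of_pos p1, Real.rpow_def_of_pos p2]
  set L1 := Real.log (1 + x)
  set L2 := Real.log (1 - x)
  have hs : L1 + L2 ≤ -x ^ 2 := by
    rw [← Real.log_mul p1.ne' p2.ne']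
    have := Real.log_le_sub_one_of_pos (mul_pos p1 p2)
    nlinarith
  have hd : 2 * x ≤ L1 - L2 := log_lb hx0 hx
  have e : Real.exp (L1 * -q) + Real.exp (L2 * -q)
      = 2 * (Real.exp (-q * (L1 + L2) / 2) * Real.cosh (q * (L1 - L2) / 2)) := by
    rw [Real.cosh_eq, mul_div_assoc', mul_add, ← Real.exp_add, ← Real.exp_add]
    rw [add_comm]
    ring_nf
  rw [e]
  have a1 : 1 + q * x ^ 2 / 2 ≤ Real.exp (-q * (L1 + L2) / 2) := by
    refine le_trans ?_ (Real.add_one_le_exp _)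
    nlinarith
  have a2 : 1 + q ^ 2 * x ^ 2 / 2 ≤ Real.cosh (q * (L1 - L2) / 2) := by
    refine le_trans ?_ (cosh_lb _)
    have : (q * x) ^ 2 ≤ (q * (L1 - L2) / 2) ^ 2 := by
      refine pow_le_pow_left₀ (by positivity) ?_ 2
      nlinarith
    nlinarith
  have a3 := mul_le_mul a1 a2 (by positivity) (by positivity)
  have : 0 ≤ q * x ^ 2 / 2 * (q ^ 2 * x ^ 2 / 2) := by positivity
  nlinarith

lemma kern1 {q A h : ℝ} (hq : 0 ≤ q) (hh : |h| < A) :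
    A ^ (-q) * (2 + q * (q + 1) * (h / A) ^ 2) ≤ (A + h) ^ (-q) + (A - h) ^ (-q) := by
  have hA : 0 < A := (abs_nonneg h).trans_lt hh
  have key : ∀ h : ℝ, 0 ≤ h → h < A →
      A ^ (-q) * (2 + q * (q + 1) * (h / A) ^ 2) ≤ (A + h) ^ (-q) + (A - h) ^ (-q) := by
    intro h h0 h1
    have hx : h / A < 1 := (div_lt_one hA).2 h1
    have hx0 : 0 ≤ h / A := by positivity
    have := kern0 hq hx0 hx
    have e1 : A + h = A * (1 + h / A) := by field_simp
    have e2 : A - h = A * (1 - h / A) := by field_simp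
    rw [e1, e2, Real.mul_rpow hA.le (by linarith), Real.mul_rpow hA.le (by linarith), ← mul_add]
    exact mul_le_mul_of_nonneg_left this (by positivity)
  rcases le_total 0 h with h0 | h0
  · exact key h h0 (by rwa [abs_of_nonneg h0] at hh)
  · have := key (-h) (by linarith) (by rwa [abs_of_nonpos h0] at hh)
    rw [neg_div, neg_sq, sub_neg_eq_add, ← sub_eq_add_neg] at this
    linarith

lemma bern {q τ : ℝ} (hτ : 0 ≤ τ) (hq : 0 ≤ q) : 1 - q * τ ≤ (1 + τ) ^ (-q) := by
  rw [Real.rpow_def_of_pos (by linarith)]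
  refine le_trans ?_ (Real.add_one_le_exp _)
  have := Real.log_le_sub_one_of_pos (show 0 < 1 + τ by linarith)
  nlinarith

lemma kern2 {n : ℕ} (hn : 1 ≤ n) {a t q : ℝ} (hqn : q = (n - 1 / 2) / 2) (z : Fin (n+1) → ℝ)
    (hz : ∑ i, z i ^ 2 = a) (ha : 0 < a)
    (ht2 : (t ^ 2 / a) * (4 * (n + 3 / 2) * (q + 2)) ≤ 1) :
    q / 2 * (t ^ 2 / a) * a ^ (-q) ≤ ∑ i, ((a + t ^ 2 + 2 * t * z i) ^ (-q)
      + (a + t ^ 2 - 2 * t * z i) ^ (-q) - 2 * a ^ (-q)) := by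
  have hn' : (1:ℝ) ≤ n := by exact_mod_cast hn
  have hq : 0 < q := by rw [hqn]; linarith
  set τ := t ^ 2 / a with hτdef
  have hτ : 0 ≤ τ := by positivity
  have hK : 2 ≤ 4 * ((n:ℝ) + 3 / 2) * (q + 2) := by nlinarith
  have hτ1 : τ < 1 := by nlinarith
  have hta : t ^ 2 = τ * a := by rw [hτdef]; field_simp
  have hA : 0 < a + t ^ 2 := by positivity
  have hAe : a + t ^ 2 = a * (1 + τ) := by rw [hta]; ring
  have step : ∀ i, (a + t ^ 2) ^ (-q) * (2 + q * (q + 1) * (2 * t * z i / (a + t ^ 2)) ^ 2)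
      - 2 * a ^ (-q) ≤ (a + t ^ 2 + 2 * t * z i) ^ (-q)
      + (a + t ^ 2 - 2 * t * z i) ^ (-q) - 2 * a ^ (-q) := by
    intro i
    refine sub_le_sub_right (kern1 hq.le ?_) _
    have hzi : z i ^ 2 ≤ a := by
      rw [← hz]; exact Finset.single_le_sum (fun j _ => sq_nonneg (z j)) (Finset.mem_univ i)
    refine abs_lt_of_sq_lt_sq ?_ hA.le
    have h1 : (2 * t * z i) ^ 2 ≤ 4 * τ * a * a := by
      rw [mul_pow, mul_pow, hta]
      have : 0 ≤ τ * a := by positivity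
      nlinarith
    have h2 : 4 * τ * a * a < (a + t ^ 2) ^ 2 := by
      rw [hAe]
      have : 0 < (1 - τ) ^ 2 * a ^ 2 := by
        have : 0 < 1 - τ := by linarith
        positivity
      nlinarith
    linarith
  refine le_trans ?_ (Finset.sum_le_sum (fun i _ => step i))
  have e1 : ∑ i : Fin (n+1), ((a + t ^ 2) ^ (-q) * (2 + q * (q + 1) * (2 * t * z i / (a + t ^ 2)) ^ 2)
      - 2 * a ^ (-q)) = (a + t ^ 2) ^ (-q) * (2 * (n + 1) + 4 * q * (q + 1) * (t ^ 2 * a / (a + t ^ 2) ^ 2))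
        - 2 * (n + 1) * a ^ (-q) := by
    have : ∀ i, ((a + t ^ 2) ^ (-q) * (2 + q * (q + 1) * (2 * t * z i / (a + t ^ 2)) ^ 2)
      - 2 * a ^ (-q)) = ((a + t ^ 2) ^ (-q) * 2 - 2 * a ^ (-q)) +
        ((a + t ^ 2) ^ (-q) * (4 * q * (q + 1) * (t ^ 2 / (a + t ^ 2) ^ 2))) * z i ^ 2 := by
      intro i; rw [div_pow]; ring
    simp_rw [this]
    rw [Finset.sum_add_distrib, ← Finset.mul_sum, hz]
    simp
    ring
  rw [e1, hAe, Real.mul_rpow ha.le (by linarith), hta]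
  have e2 : τ * a * a / (a * (1 + τ)) ^ 2 = τ / (1 + τ) ^ 2 := by field_simp
  rw [e2]
  have e3 : (1 + τ) ^ (-q) / (1 + τ) ^ 2 = (1 + τ) ^ (-(q + 2)) := by
    rw [neg_add, ← sub_eq_add_neg, Real.rpow_sub (by linarith)]
    norm_cast
  have b1 := bern hτ hq.le
  have b2 := bern hτ (show 0 ≤ q + 2 by linarith)
  have e4 : a ^ (-q) * (1 + τ) ^ (-q) * (2 * (n + 1) + 4 * q * (q + 1) * (τ / (1 + τ) ^ 2))
        - 2 * (n + 1) * a ^ (-q) = a ^ (-q) * (2 * (n + 1) * (1 + τ) ^ (-q)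
          + 4 * q * (q + 1) * τ * (1 + τ) ^ (-(q + 2)) - 2 * (n + 1)) := by
    rw [← e3]; ring
  rw [e4, mul_comm _ (a ^ (-q))]
  refine mul_le_mul_of_nonneg_left ?_ (by positivity)
  have c1 : 2 * ((n:ℝ) + 1) * (1 - q * τ) ≤ 2 * (n + 1) * (1 + τ) ^ (-q) :=
    mul_le_mul_of_nonneg_left b1 (by positivity)
  have c2 : 4 * q * (q + 1) * τ * (1 - (q + 2) * τ) ≤ 4 * q * (q + 1) * τ * (1 + τ) ^ (-(q + 2)) :=
    mul_le_mul_of_nonneg_left b2 (by positivity)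
  have c3 : q / 2 * τ ≤ 2 * ((n:ℝ) + 1) * (1 - q * τ) + 4 * q * (q + 1) * τ * (1 - (q + 2) * τ)
      - 2 * (n + 1) := by
    have hnq : (n:ℝ) = 2 * q + 1 / 2 := by rw [hqn]; ring
    rw [hnq] at ht2 ⊢
    have : 0 ≤ q * τ * (1 - τ * (4 * (2 * q + 1 / 2 + 3 / 2) * (q + 2))) := by
      have : 0 ≤ 1 - τ * (4 * (2 * q + 1 / 2 + 3 / 2) * (q + 2)) := by linarith
      positivity
    nlinarith
  linarith

section pot

variable {n : ℕ} {μ : Measure (EuclideanSpace ℝ (Fin (n+1)))}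
  {S : Set (EuclideanSpace ℝ (Fin (n+1)))} {s : ℝ}

lemma pot_dom (hs : 0 ≤ s) {z : EuclideanSpace ℝ (Fin (n+1))} {δ : ℝ} (hδ : 0 < δ)
    (hμS : μ Sᶜ = 0) (hz : ∀ ξ ∈ S, δ ≤ ‖z - ξ‖) :
    ∀ᵐ ξ ∂μ, ‖‖z - ξ‖ ^ (-s)‖ ≤ δ ^ (-s) := by
  have : ∀ᵐ ξ ∂μ, ξ ∈ S := hμS
  filter_upwards [this] with ξ hξ
  rw [Real.norm_of_nonneg (by positivity)]
  exact Real.rpow_le_rpow_of_nonpos hδ (hz ξ hξ) (by linarith)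

lemma pot_meas (z : EuclideanSpace ℝ (Fin (n+1))) :
    Measurable (fun ξ : EuclideanSpace ℝ (Fin (n+1)) => ‖z - ξ‖ ^ (-s)) := by
  fun_prop

lemma pot_delta (hS : IsClosed S) {z : EuclideanSpace ℝ (Fin (n+1))} (hz : z ∉ S) :
    ∃ δ, 0 < δ ∧ ∀ z', ‖z' - z‖ < δ → ∀ ξ ∈ S, δ ≤ ‖z' - ξ‖ := by
  obtain ⟨δ, hδ, hb⟩ := Metric.isOpen_iff.1 hS.isOpen_compl z hz
  refine ⟨δ / 2, half_pos hδ, fun z' hz' ξ hξ => ?_⟩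
  by_contra h
  push Not at h
  refine absurd hξ (hb (?_ : ξ ∈ ball z δ))
  rw [mem_ball, dist_comm, dist_eq_norm]
  calc ‖z - ξ‖ = ‖(z' - ξ) - (z' - z)‖ := by congr 1; abel
    _ ≤ ‖z' - ξ‖ + ‖z' - z‖ := norm_sub_le _ _
    _ < δ := by linarith

lemma pot_int [IsFiniteMeasure μ] (hs : 0 ≤ s) (hS : IsClosed S) (hμS : μ Sᶜ = 0)
    {z : EuclideanSpace ℝ (Fin (n+1))} (hz : z ∉ S) :
    Integrable (fun ξ => ‖z - ξ‖ ^ (-s)) μ := by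
  obtain ⟨δ, hδ, h⟩ := pot_delta hS hz
  exact Integrable.of_bound (pot_meas z).aestronglyMeasurable _
    (pot_dom hs hδ hμS (h z (by simpa using hδ)))

lemma pot_cont [IsFiniteMeasure μ] (hs : 0 ≤ s) (hS : IsClosed S) (hμS : μ Sᶜ = 0)
    {z : EuclideanSpace ℝ (Fin (n+1))} (hz : z ∉ S) :
    ContinuousAt (fun z => ∫ ξ, ‖z - ξ‖ ^ (-s) ∂μ) z := by
  obtain ⟨δ, hδ, h⟩ := pot_delta hS hz
  refine continuousAt_of_dominated (bound := fun _ => δ ^ (-s)) ?_ ?_ (integrable_const _) ?_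
  · exact Eventually.of_forall (fun z => (pot_meas z).aestronglyMeasurable)
  · filter_upwards [ball_mem_nhds z hδ] with z' hz'
    exact pot_dom hs hδ hμS (h z' (by simpa [dist_eq_norm] using hz'))
  · have : ∀ᵐ ξ ∂μ, ξ ∈ S := hμS
    filter_upwards [this] with ξ hξ
    have h0 : ‖z - ξ‖ ≠ 0 := (hδ.trans_le (h z (by simpa using hδ) ξ hξ)).ne'
    exact ContinuousAt.rpow_const (by fun_prop) (Or.inl h0)

lemma norm_rpow_sq {q : ℝ} (hs : s = 2 * q) (v : EuclideanSpace ℝ (Fin (n+1))) :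
    ‖v‖ ^ (-s) = (‖v‖ ^ 2) ^ (-q) := by
  rw [← Real.rpow_natCast, ← Real.rpow_mul (norm_nonneg _)]
  congr 1; rw [hs]; push_cast; ring

lemma norm_add_e (v : EuclideanSpace ℝ (Fin (n+1))) (t : ℝ) (i : Fin (n+1)) :
    ‖v + t • EuclideanSpace.single i (1:ℝ)‖ ^ 2 = ‖v‖ ^ 2 + t ^ 2 + 2 * t * v i := by
  rw [norm_add_sq_real, norm_smul, inner_smul_right]
  simp [EuclideanSpace.inner_single_right]
  ring

lemma norm_sub_e (v : EuclideanSpace ℝ (Fin (n+1))) (t : ℝ) (i : Fin (n+1)) :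
    ‖v - t • EuclideanSpace.single i (1:ℝ)‖ ^ 2 = ‖v‖ ^ 2 + t ^ 2 - 2 * t * v i := by
  rw [norm_sub_sq_real, norm_smul, inner_smul_right]
  simp [EuclideanSpace.inner_single_right]
  ring

lemma pot_sd [IsFiniteMeasure μ] (hn : 1 ≤ n) (hs : s = n - 1 / 2) (hS : IsClosed S)
    (hμS : μ Sᶜ = 0) (hμ : 0 < μ.real univ) {x : EuclideanSpace ℝ (Fin (n+1))} {ρ : ℝ} (hρ : 0 < ρ)
    (hμx : μ (ball x ρ)ᶜ = 0) {z : EuclideanSpace ℝ (Fin (n+1))} (hz : z ∉ S) :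
    ∃ c : ℝ, 0 < c ∧ ∀ᶠ t : ℝ in 𝓝[>] 0, c * t ^ 2 ≤ ∑ i : Fin (n+1),
      ((∫ ξ, ‖z + t • EuclideanSpace.single i (1:ℝ) - ξ‖ ^ (-s) ∂μ)
      + (∫ ξ, ‖z - t • EuclideanSpace.single i (1:ℝ) - ξ‖ ^ (-s) ∂μ)
      - 2 * ∫ ξ, ‖z - ξ‖ ^ (-s) ∂μ) := by
  obtain ⟨δ, hδ, h⟩ := pot_delta hS hz
  have hn' : (1:ℝ) ≤ n := by exact_mod_cast hn
  obtain ⟨q, hq⟩ : ∃ q, q = ((n:ℝ) - 1 / 2) / 2 := ⟨_, rfl⟩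
  have hsq : s = 2 * q := by rw [hs, hq]; ring
  have hq0 : 0 < q := by rw [hq]; linarith
  have hs0 : 0 ≤ s := by linarith
  set M := dist z x + ρ with hM
  have hM0 : 0 < M := by positivity
  set κ := q / 2 * (M ^ 2) ^ (-q - 1) with hκ
  have hκ0 : 0 < κ := by positivity
  refine ⟨κ * μ.real univ, by positivity, ?_⟩
  set K := 4 * ((n:ℝ) + 3 / 2) * (q + 2) with hK
  have hK0 : 0 < K := by positivity
  have hev1 : ∀ᶠ t : ℝ in 𝓝[>] 0, t ∈ Ioo 0 δ := Ioo_mem_nhdsGT hδ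
  have hev2 : ∀ᶠ t : ℝ in 𝓝[>] 0, t ^ 2 / δ ^ 2 * K < 1 := by
    have : Tendsto (fun t : ℝ => t ^ 2 / δ ^ 2 * K) (𝓝 0) (𝓝 (0 ^ 2 / δ ^ 2 * K)) :=
      (Continuous.tendsto (by fun_prop) 0)
    exact (this.mono_left nhdsWithin_le_nhds).eventually (gt_mem_nhds (by simp))
  filter_upwards [hev1, hev2] with t ht htK
  have nS : ∀ z', ‖z' - z‖ < δ → z' ∉ S := fun z' hz' hS' => by
    have := h z' hz' z' hS'; simp at this; linarith
  have i0 := pot_int (s := s) (μ := μ) hs0 hS hμS hz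
  have i1 : ∀ i, Integrable (fun ξ => ‖z + t • EuclideanSpace.single i (1:ℝ) - ξ‖ ^ (-s)) μ :=
    fun i => pot_int hs0 hS hμS (nS _ (by simp [norm_smul, abs_of_pos ht.1, ht.2]))
  have i2 : ∀ i, Integrable (fun ξ => ‖z - t • EuclideanSpace.single i (1:ℝ) - ξ‖ ^ (-s)) μ :=
    fun i => pot_int hs0 hS hμS (nS _ (by simp [norm_smul, abs_of_pos ht.1, ht.2]))
  have i3 : ∀ i, Integrable (fun ξ => ‖z + t • EuclideanSpace.single i (1:ℝ) - ξ‖ ^ (-s)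
      + ‖z - t • EuclideanSpace.single i (1:ℝ) - ξ‖ ^ (-s) - 2 * ‖z - ξ‖ ^ (-s)) μ :=
    fun i => ((i1 i).add (i2 i)).sub (i0.const_mul 2)
  have e : ∑ i : Fin (n+1),
      ((∫ ξ, ‖z + t • EuclideanSpace.single i (1:ℝ) - ξ‖ ^ (-s) ∂μ)
      + (∫ ξ, ‖z - t • EuclideanSpace.single i (1:ℝ) - ξ‖ ^ (-s) ∂μ)
      - 2 * ∫ ξ, ‖z - ξ‖ ^ (-s) ∂μ)
      = ∫ ξ, ∑ i : Fin (n+1), (‖z + t • EuclideanSpace.single i (1:ℝ) - ξ‖ ^ (-s)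
      + ‖z - t • EuclideanSpace.single i (1:ℝ) - ξ‖ ^ (-s) - 2 * ‖z - ξ‖ ^ (-s)) ∂μ := by
    rw [integral_finsetSum _ (fun i _ => i3 i)]
    refine Finset.sum_congr rfl (fun i _ => ?_)
    have g1 := integral_sub (f := fun ξ => ‖z + t • EuclideanSpace.single i (1:ℝ) - ξ‖ ^ (-s)
      + ‖z - t • EuclideanSpace.single i (1:ℝ) - ξ‖ ^ (-s)) ((i1 i).add (i2 i)) (i0.const_mul 2)
    rw [integral_add (i1 i) (i2 i), integral_const_mul] at g1
    exact g1.symm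
  rw [e]
  have e2 : κ * μ.real univ * t ^ 2 = ∫ _ξ, κ * t ^ 2 ∂μ := by
    rw [integral_const, smul_eq_mul]; ring
  rw [e2]
  refine integral_mono_ae (integrable_const _) (integrable_finsetSum _ (fun i _ => i3 i)) ?_
  have a1 : ∀ᵐ ξ ∂μ, ξ ∈ S := hμS
  have a2 : ∀ᵐ ξ ∂μ, ξ ∈ ball x ρ := hμx
  filter_upwards [a1, a2] with ξ hξ hξx
  have hδ' := h z (by simpa using hδ) ξ hξ
  have hMz : ‖z - ξ‖ ≤ M := by
    rw [← dist_eq_norm]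
    have := dist_triangle z x ξ
    have h2 : dist x ξ < ρ := by rw [dist_comm]; exact hξx
    linarith
  have ha : 0 < ‖z - ξ‖ ^ 2 := by have : 0 < ‖z - ξ‖ := hδ.trans_le hδ'
                                  positivity
  have k2 := kern2 hn (a := ‖z - ξ‖ ^ 2) (t := t) hq (fun i => (z - ξ) i)
    (by rw [EuclideanSpace.norm_sq_eq]; simp) ha (by
      refine le_trans ?_ htK.le
      refine mul_le_mul_of_nonneg_right ?_ hK0.le
      gcongr)
  have e3 : ∀ i, z + t • EuclideanSpace.single i (1:ℝ) - ξ = (z - ξ) + t • EuclideanSpace.single i (1:ℝ) :=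
    fun i => by abel
  have e4 : ∀ i, z - t • EuclideanSpace.single i (1:ℝ) - ξ = (z - ξ) - t • EuclideanSpace.single i (1:ℝ) :=
    fun i => by abel
  simp_rw [e3, e4, norm_rpow_sq hsq, norm_add_e, norm_sub_e]
  refine le_trans ?_ k2
  have e5 : q / 2 * (t ^ 2 / ‖z - ξ‖ ^ 2) * (‖z - ξ‖ ^ 2) ^ (-q)
      = q / 2 * (‖z - ξ‖ ^ 2) ^ (-q - 1) * t ^ 2 := by
    rw [Real.rpow_sub ha, Real.rpow_one]; ring
  rw [e5, hκ]
  have : (M ^ 2) ^ (-q - 1) ≤ (‖z - ξ‖ ^ 2) ^ (-q - 1) :=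
    Real.rpow_le_rpow_of_nonpos ha (by gcongr) (by linarith)
  gcongr

lemma pot_ub (hs : s = n - 1 / 2) (hs0 : 0 ≤ s) {B ρ : ℝ} (hB : 0 ≤ B) (hρ : 0 < ρ)
    (hm : μ univ ≤ ENNReal.ofReal (B * ρ ^ n))
    (hg : ∀ z, ∀ t, 0 < t → t ≤ ρ → μ (closedBall z t) ≤ ENNReal.ofReal (B * t ^ n))
    (z : EuclideanSpace ℝ (Fin (n+1))) (hz : ∀ᵐ ξ ∂μ, z ≠ ξ) :
    ∫ ξ, ‖z - ξ‖ ^ (-s) ∂μ ≤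
      B * (1 + 2 ^ s / (1 - (1 / 2 : ℝ) ^ (1 / 2 : ℝ))) * ρ ^ (1 / 2 : ℝ) := by
  set β : ℝ := (1 / 2 : ℝ) ^ (1 / 2 : ℝ) with hβ
  have hβ0 : 0 ≤ β := by positivity
  have hβ1 : β < 1 := Real.rpow_lt_one (by norm_num) (by norm_num) (by norm_num)
  have hden : 0 < 1 - β := by linarith
  rw [integral_eq_lintegral_of_nonneg_ae (Eventually.of_forall fun ξ => by positivity)
    (pot_meas z).aestronglyMeasurable]
  refine ENNReal.toReal_le_of_le_ofReal (by positivity) ?_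
  let G : ℕ → EuclideanSpace ℝ (Fin (n+1)) → ℝ≥0∞ := fun k =>
    (closedBall z (ρ * (1 / 2) ^ k)).indicator
      (fun _ => ENNReal.ofReal ((ρ * (1 / 2) ^ (k + 1)) ^ (-s)))
  have hGm : ∀ k, Measurable (G k) := fun k => measurable_const.indicator measurableSet_closedBall
  have hpt : ∀ᵐ ξ ∂μ, ENNReal.ofReal (‖z - ξ‖ ^ (-s)) ≤ ENNReal.ofReal (ρ ^ (-s)) + ∑' k, G k ξ := by
    filter_upwards [hz] with ξ hξ
    have h0 : 0 < ‖z - ξ‖ := norm_pos_iff.2 (sub_ne_zero.2 hξ)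
    rcases le_total ρ ‖z - ξ‖ with h1 | h1
    · refine le_trans (ENNReal.ofReal_le_ofReal ?_) le_self_add
      exact Real.rpow_le_rpow_of_nonpos hρ h1 (by linarith)
    · obtain ⟨k, hk1, hk2⟩ := exists_nat_pow_near_of_lt_one (x := ‖z - ξ‖ / ρ) (y := (1 / 2 : ℝ))
        (by positivity) ((div_le_one hρ).2 h1) (by norm_num) (by norm_num)
      refine le_trans ?_ le_add_self
      refine le_trans ?_ (ENNReal.le_tsum k)
      have hmem : ξ ∈ closedBall z (ρ * (1 / 2) ^ k) := by
        rw [mem_closedBall, dist_comm, dist_eq_norm]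
        rw [div_le_iff₀ hρ] at hk2; linarith
      simp only [G, indicator_of_mem hmem]
      refine ENNReal.ofReal_le_ofReal (Real.rpow_le_rpow_of_nonpos (by positivity) ?_ (by linarith))
      rw [lt_div_iff₀ hρ] at hk1; linarith
  have hpow : ∀ t : ℝ, 0 < t → t ^ (-s) * t ^ n = t ^ (1 / 2 : ℝ) := by
    intro t ht
    rw [← Real.rpow_natCast, ← Real.rpow_add ht]; congr 1; rw [hs]; ring
  have hGi : ∀ k, ∫⁻ ξ, G k ξ ∂μ ≤ ENNReal.ofReal (B * 2 ^ s * ρ ^ (1 / 2 : ℝ) * β ^ k) := by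
    intro k
    have h2k : 0 < ρ * (1 / 2) ^ k := by positivity
    rw [lintegral_indicator_const measurableSet_closedBall]
    refine (mul_le_mul_right (hg z _ h2k ?_) _).trans ?_
    · have : (1 / 2 : ℝ) ^ k ≤ 1 := pow_le_one₀ (by norm_num) (by norm_num)
      nlinarith
    · rw [← ENNReal.ofReal_mul (by positivity)]
      refine ENNReal.ofReal_le_ofReal (le_of_eq ?_)
      have e1 : (ρ * (1 / 2) ^ (k + 1)) ^ (-s) = (ρ * (1 / 2) ^ k) ^ (-s) * 2 ^ s := by
        rw [pow_succ, ← mul_assoc, Real.mul_rpow h2k.le (by norm_num)]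
        congr 1
        rw [one_div, Real.inv_rpow (by norm_num), Real.rpow_neg (by norm_num), inv_inv]
      have e2 : (ρ * (1 / 2) ^ k) ^ (1 / 2 : ℝ) = ρ ^ (1 / 2 : ℝ) * β ^ k := by
        rw [Real.mul_rpow hρ.le (by positivity), hβ, ← Real.rpow_natCast, ← Real.rpow_natCast,
          ← Real.rpow_mul (by norm_num), ← Real.rpow_mul (by norm_num), mul_comm (k:ℝ)]
      rw [e1]
      have := hpow _ h2k
      rw [e2] at this
      linear_combination B * 2 ^ s * this
  calc ∫⁻ ξ, ENNReal.ofReal (‖z - ξ‖ ^ (-s)) ∂μ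
      ≤ ∫⁻ ξ, (ENNReal.ofReal (ρ ^ (-s)) + ∑' k, G k ξ) ∂μ := lintegral_mono_ae hpt
    _ = ENNReal.ofReal (ρ ^ (-s)) * μ univ + ∑' k, ∫⁻ ξ, G k ξ ∂μ := by
        rw [lintegral_add_left measurable_const, lintegral_const,
          lintegral_tsum (fun k => (hGm k).aemeasurable)]
    _ ≤ ENNReal.ofReal (ρ ^ (-s)) * ENNReal.ofReal (B * ρ ^ n)
        + ∑' k, ENNReal.ofReal (B * 2 ^ s * ρ ^ (1 / 2 : ℝ) * β ^ k) := by
        refine add_le_add (mul_le_mul_right hm _) (ENNReal.tsum_le_tsum hGi)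
    _ = ENNReal.ofReal (B * (1 + 2 ^ s / (1 - β)) * ρ ^ (1 / 2 : ℝ)) := by
        rw [← ENNReal.ofReal_tsum_of_nonneg (fun k => by positivity)
          ((summable_geometric_of_lt_one hβ0 hβ1).mul_left _), tsum_mul_left,
          tsum_geometric_of_lt_one hβ0 hβ1, ← ENNReal.ofReal_mul (by positivity),
          ← ENNReal.ofReal_add (by positivity) (by positivity)]
        congr 1
        have := hpow _ hρ
        rw [show (2:ℝ) ^ s / (1 - β) = 2 ^ s * (1 - β)⁻¹ from div_eq_mul_inv _ _]
        linear_combination B * this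

end pot

lemma case_zero {Ω : Set (EuclideanSpace ℝ (Fin (0+1)))}
    {ω : EuclideanSpace ℝ (Fin (0+1)) → Measure (EuclideanSpace ℝ (Fin (0+1)))}
    (hΩ : IsOpen Ω) (hω : IsHarmonicMeasure Ω ω) {x : EuclideanSpace ℝ (Fin (0+1))}
    (hx : x ∈ frontier Ω) {r : ℝ} (hr : 0 < r) :
    ∀ y ∈ Ω ∩ closedBall x r, ENNReal.ofReal (9 / 49) ≤ ω y (ball x (2 * r)) := by
  have hxΩ : x ∉ Ω := by rw [hΩ.frontier_eq] at hx; exact hx.2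
  have hR : 0 < 7 / 4 * r := by linarith
  -- cut off so that the function is at most one everywhere
  refine reduction (w := fun z => max 0 (1 - dist z x / (7 / 4 * r)) ^ 2) hr hΩ hω ?_ ?_ ?_ ?_ ?_
  · intro p hp
    have h1 : max 0 (1 - dist p x / (7 / 4 * r)) ≤ 1 :=
      max_le zero_le_one (by have : 0 ≤ dist p x / (7 / 4 * r) := by positivity
                             linarith)
    exact pow_le_one₀ (le_max_left _ _) h1
  · exact Continuous.continuousOn (by fun_prop)
  · intro p hp h
    simp only [h]
    rw [div_self hR.ne']; simp
  · intro p hp hpb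
    have hpx : p ≠ x := fun h => hxΩ (h ▸ hp)
    have hd : ∀ z : EuclideanSpace ℝ (Fin (0+1)), dist z x = |z 0 - x 0| := by
      intro z; rw [EuclideanSpace.dist_eq]; simp [Real.dist_eq, Real.sqrt_sq_eq_abs]
    have hd0 : 0 < |p 0 - x 0| := by rw [← hd]; exact dist_pos.2 hpx
    have hdR : |p 0 - x 0| < 7 / 4 * r := by rw [← hd]; exact hpb
    refine ⟨2 / (7 / 4 * r) ^ 2, by positivity, ?_⟩
    have hev : ∀ᶠ t : ℝ in 𝓝[>] 0, t ∈ Ioo 0 (min |p 0 - x 0| (7 / 4 * r - |p 0 - x 0|)) :=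
      Ioo_mem_nhdsGT (lt_min hd0 (by linarith))
    filter_upwards [hev] with t ht
    have ht0 := ht.1
    have ht1 := ht.2.trans_le (min_le_left _ _)
    have ht2 := ht.2.trans_le (min_le_right _ _)
    have hpos : ∀ d, d ≤ 7 / 4 * r → max 0 (1 - d / (7 / 4 * r)) = 1 - d / (7 / 4 * r) := by
      intro d h
      exact max_eq_right (by have := (div_le_one hR).2 h; linarith)
    rw [Fin.sum_univ_one]
    simp only [hd]
    have c1 : (p + t • EuclideanSpace.single (0 : Fin (0+1)) (1:ℝ)) 0 - x 0 = (p 0 - x 0) + t := by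
      simp; ring
    have c2 : (p - t • EuclideanSpace.single (0 : Fin (0+1)) (1:ℝ)) 0 - x 0 = (p 0 - x 0) - t := by
      simp; ring
    rw [c1, c2]
    generalize p 0 - x 0 = v at *
    rcases le_total 0 v with h | h
    · rw [abs_of_nonneg h] at *
      rw [abs_of_nonneg (by linarith : 0 ≤ v + t), abs_of_nonneg (by linarith : 0 ≤ v - t),
        hpos _ (by linarith), hpos _ (by linarith), hpos _ (by linarith)]
      apply le_of_eq; field_simp; ring
    · rw [abs_of_nonpos h] at *
      rw [abs_of_nonpos (by linarith : v + t ≤ 0), abs_of_nonpos (by linarith : v - t ≤ 0),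
        hpos _ (by linarith), hpos _ (by linarith), hpos _ (by linarith)]
      apply le_of_eq; field_simp; ring
  · intro y hy hyr
    have h1 : dist y x ≤ r := hyr
    have h2 : dist y x / (7 / 4 * r) ≤ 4 / 7 := by rw [div_le_iff₀ hR]; linarith
    have h3 : 3 / 7 ≤ max 0 (1 - dist y x / (7 / 4 * r)) := le_max_of_le_right (by linarith)
    have h4 := pow_le_pow_left₀ (by norm_num) h3 2
    refine le_trans ?_ h4
    norm_num

lemma case_pos {n : ℕ} (hn : 1 ≤ n) {Cadr : ℝ} (hC : 1 ≤ Cadr) {s : ℝ} (hs : s = n - 1 / 2)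
    {Ω : Set (EuclideanSpace ℝ (Fin (n+1)))}
    {ω : EuclideanSpace ℝ (Fin (n+1)) → Measure (EuclideanSpace ℝ (Fin (n+1)))}
    (hΩ : IsOpen Ω) (hA : IsADR n (frontier Ω) Cadr)
    (hω : IsHarmonicMeasure Ω ω) {x : EuclideanSpace ℝ (Fin (n+1))}
    (hx : x ∈ frontier Ω) {r : ℝ} (hr : 0 < r)
    (hd : ENNReal.ofReal (2 * r) ≤ EMetric.diam (frontier Ω)) :
    ∀ y ∈ Ω ∩ closedBall x r, ENNReal.ofReal ((5 ^ (-s) - 6 ^ (-s)) * Cadr⁻¹ /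
      (Cadr * 3 ^ n * (1 + 2 ^ s / (1 - (1 / 2 : ℝ) ^ (1 / 2 : ℝ)))))
      ≤ ω y (ball x (2 * r)) := by
  have hn' : (1:ℝ) ≤ n := by exact_mod_cast hn
  have hs0 : 0 < s := by rw [hs]; linarith
  set S := frontier Ω with hSdef
  obtain ⟨hS, -, hADR⟩ := hA
  have hzS : ∀ z ∈ Ω, z ∉ S := by
    intro z hz h; rw [hSdef, hΩ.frontier_eq] at h; exact h.2 hz
  obtain ⟨ρ, hρr⟩ : ∃ ρ, r = 4 * ρ := ⟨r / 4, by ring⟩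
  have hρ : 0 < ρ := by linarith
  set σ := (Measure.hausdorffMeasure (X := EuclideanSpace ℝ (Fin (n+1))) (n:ℝ)).restrict S with hσ
  set μ := σ.restrict (ball x ρ) with hμ
  have hlt : ∀ t, t < 2 * r → ENNReal.ofReal t < EMetric.diam S := fun t ht =>
    lt_of_lt_of_le ((ENNReal.ofReal_lt_ofReal_iff (by linarith)).2 ht) hd
  have hmu : μ univ = σ (ball x ρ) := by rw [hμ, Measure.restrict_apply_univ]
  obtain ⟨hlow, hupp⟩ := hADR x hx ρ hρ (hlt ρ (by linarith))
  rw [← hmu] at hlow hupp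
  have hfin : IsFiniteMeasure μ := ⟨hupp.trans_lt ENNReal.ofReal_lt_top⟩
  have hμS : μ Sᶜ = 0 := by
    refine le_antisymm ((Measure.restrict_le_self _).trans ?_) zero_le
    rw [hσ, Measure.restrict_apply hS.measurableSet.compl]; simp
  have hμx : μ (ball x ρ)ᶜ = 0 := by
    rw [hμ, Measure.restrict_apply measurableSet_ball.compl]; simp
  have haS : ∀ᵐ ξ ∂μ, ξ ∈ S := hμS
  have hax : ∀ᵐ ξ ∂μ, ξ ∈ ball x ρ := hμx
  set m := μ.real univ with hm
  have hmlow : Cadr⁻¹ * ρ ^ n ≤ m := by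
    rw [hm, measureReal_def]
    exact (ENNReal.ofReal_le_iff_le_toReal (measure_ne_top _ _)).1 hlow
  have hC0 : 0 < Cadr := by linarith
  have hm0 : 0 < m := lt_of_lt_of_le (by positivity) hmlow
  set Γ := 1 + 2 ^ s / (1 - (1 / 2 : ℝ) ^ (1 / 2 : ℝ)) with hΓ
  have hβ1 : (1 / 2 : ℝ) ^ (1 / 2 : ℝ) < 1 :=
    Real.rpow_lt_one (by norm_num) (by norm_num) (by norm_num)
  have hΓ0 : 0 < Γ := by
    have : 0 < 1 - (1 / 2 : ℝ) ^ (1 / 2 : ℝ) := by linarith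
    positivity
  have hub := pot_ub (μ := μ) (B := Cadr * 3 ^ n) (ρ := ρ) hs hs0.le (by positivity) hρ
    (by refine hupp.trans (ENNReal.ofReal_le_ofReal ?_)
        have : (1:ℝ) ≤ 3 ^ n := one_le_pow₀ (by norm_num)
        have h2 : 0 ≤ Cadr * ρ ^ n := by positivity
        nlinarith)
    (by
      intro z t ht htρ
      by_cases hne : (closedBall z t ∩ S).Nonempty
      · obtain ⟨ξ, hξ1, hξS⟩ := hne
        have hb := (hADR ξ hξS (3 * t) (by linarith) (hlt _ (by linarith))).2
        have hsub : closedBall z t ⊆ ball ξ (3 * t) := by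
          intro η hη
          rw [mem_closedBall] at hη hξ1
          rw [mem_ball]
          have := dist_triangle_right η ξ z
          linarith
        refine (Measure.restrict_le_self _).trans ((measure_mono hsub).trans (hb.trans ?_))
        refine ENNReal.ofReal_le_ofReal (le_of_eq ?_)
        rw [mul_pow]; ring
      · have : σ (closedBall z t) = 0 := by
          rw [hσ, Measure.restrict_apply measurableSet_closedBall, not_nonempty_iff_eq_empty.1 hne]
          simp
        refine (Measure.restrict_le_self _).trans ?_
        rw [this]; exact zero_le)
  set W : EuclideanSpace ℝ (Fin (n+1)) → ℝ := fun z => ∫ ξ, ‖z - ξ‖ ^ (-s) ∂μ with hW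
  set Λ := Cadr * 3 ^ n * Γ * ρ ^ (1 / 2 : ℝ) with hΛ
  have hΛ0 : 0 < Λ := by positivity
  have hWub : ∀ z ∈ Ω, W z ≤ Λ := fun z hz => hub z (by
    filter_upwards [haS] with ξ hξ h
    exact hzS z hz (h ▸ hξ))
  set T := (6 * ρ) ^ (-s) * m with hT
  have hT0 : 0 ≤ T := by positivity
  refine reduction (w := fun z => (W z - T) / Λ) hr hΩ hω ?_ ?_ ?_ ?_ ?_
  · intro p hp
    rw [div_le_one hΛ0]; have := hWub p hp; linarith
  · intro p hp
    exact (((pot_cont hs0.le hS hμS (hzS p hp)).sub continuousAt_const).div_const _).continuousWithinAt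
  · intro p hp hdist
    refine div_nonpos_of_nonpos_of_nonneg ?_ hΛ0.le
    have : W p ≤ ∫ _ξ, (6 * ρ) ^ (-s) ∂μ := by
      refine integral_mono_ae (pot_int hs0.le hS hμS (hzS p hp)) (integrable_const _) ?_
      filter_upwards [hax] with ξ hξ
      refine Real.rpow_le_rpow_of_nonpos (by positivity) ?_ (by linarith)
      rw [← dist_eq_norm]
      have := dist_triangle p ξ x
      have h2 : dist ξ x < ρ := hξ
      linarith
    rw [integral_const, smul_eq_mul] at this
    rw [hT]; linarith
  · intro p hp hpb
    obtain ⟨c, hc, hev⟩ := pot_sd (μ := μ) (s := s) hn hs hS hμS hm0 hρ hμx (hzS p hp)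
    refine ⟨c / Λ, by positivity, ?_⟩
    filter_upwards [hev] with t ht
    have e : ∑ i : Fin (n+1), ((W (p + t • EuclideanSpace.single i (1:ℝ)) - T) / Λ
      + (W (p - t • EuclideanSpace.single i (1:ℝ)) - T) / Λ - 2 * ((W p - T) / Λ))
      = (∑ i : Fin (n+1), (W (p + t • EuclideanSpace.single i (1:ℝ))
      + W (p - t • EuclideanSpace.single i (1:ℝ)) - 2 * W p)) / Λ := by
      rw [Finset.sum_div]
      refine Finset.sum_congr rfl (fun i _ => ?_)
      ring
    rw [e, div_mul_eq_mul_div]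
    exact div_le_div_of_nonneg_right ht hΛ0.le
  · intro y hy hyr
    have hlowW : (5 * ρ) ^ (-s) * m ≤ W y := by
      have : ∫ _ξ, (5 * ρ) ^ (-s) ∂μ ≤ W y := by
        refine integral_mono_ae (integrable_const _) (pot_int hs0.le hS hμS (hzS y hy)) ?_
        filter_upwards [haS, hax] with ξ hξS hξ
        have hne : y ≠ ξ := fun h => hzS y hy (h ▸ hξS)
        refine Real.rpow_le_rpow_of_nonpos (norm_pos_iff.2 (sub_ne_zero.2 hne)) ?_ (by linarith)
        rw [← dist_eq_norm]
        have := dist_triangle_right y ξ x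
        have h2 : dist ξ x < ρ := hξ
        have h3 : dist y x ≤ r := hyr
        linarith
      rw [integral_const, smul_eq_mul] at this
      linarith
    have h56 : (0:ℝ) ≤ 5 ^ (-s) - 6 ^ (-s) := by
      have : (6:ℝ) ^ (-s) ≤ 5 ^ (-s) :=
        Real.rpow_le_rpow_of_nonpos (by norm_num) (by norm_num) (by linarith)
      linarith
    have hpow : ρ ^ (-s) * ρ ^ n = ρ ^ (1 / 2 : ℝ) := by
      rw [← Real.rpow_natCast, ← Real.rpow_add hρ]; congr 1; rw [hs]; ring
    have hmain : (5 ^ (-s) - 6 ^ (-s)) * Cadr⁻¹ * ρ ^ (1 / 2 : ℝ) ≤ W y - T := by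
      rw [hT, Real.mul_rpow (by norm_num) hρ.le]
      rw [Real.mul_rpow (by norm_num) hρ.le] at hlowW
      have h1 : (5 ^ (-s) - 6 ^ (-s)) * ρ ^ (-s) * (Cadr⁻¹ * ρ ^ n)
          ≤ (5 ^ (-s) - 6 ^ (-s)) * ρ ^ (-s) * m :=
        mul_le_mul_of_nonneg_left hmlow (by positivity)
      rw [← hpow]
      linarith
    rw [le_div_iff₀ hΛ0, hΛ]
    refine le_trans (le_of_eq ?_) hmain
    field_simp

/-- Bourgain's estimate.  Let `Ω ⊊ ℝ^{n+1}` be open with `n`-ADR boundary.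
Then there is `c > 0`, depending only on `n` and the ADR constant, such that for every
`x ∈ ∂Ω` and `0 < r ≤ diam(∂Ω)/2`, the harmonic measure satisfies
`ω^y(B(x,2r)) ≥ c` for all `y ∈ Ω ∩ B̄(x,r)`. -/
theorem bourgain_estimate (n : ℕ) (Cadr : ℝ) (hCadr : 1 ≤ Cadr) :
    ∃ c : ℝ, 0 < c ∧
      ∀ (Ω : Set (EuclideanSpace ℝ (Fin (n+1))))
        (ω : EuclideanSpace ℝ (Fin (n+1)) → Measure (EuclideanSpace ℝ (Fin (n+1)))),
        IsOpen Ω → Ω.Nonempty → Ω ≠ univ →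
        IsADR n (frontier Ω) Cadr →
        IsHarmonicMeasure Ω ω →
        ∀ x ∈ frontier Ω, ∀ r : ℝ, 0 < r →
          ENNReal.ofReal (2 * r) ≤ EMetric.diam (frontier Ω) →
          ∀ y ∈ Ω ∩ closedBall x r,
            ENNReal.ofReal c ≤ ω y (ball x (2 * r)) := by

  rcases Nat.eq_zero_or_pos n with rfl | hn
  · exact ⟨9 / 49, by norm_num, fun Ω ω hΩ _ _ _ hω x hx r hr _ => case_zero hΩ hω hx hr⟩
  · have hn' : (1:ℝ) ≤ n := by exact_mod_cast hn
    obtain ⟨s, hs⟩ : ∃ s : ℝ, s = n - 1 / 2 := ⟨_, rfl⟩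
    refine ⟨(5 ^ (-s) - 6 ^ (-s)) * Cadr⁻¹ /
      (Cadr * 3 ^ n * (1 + 2 ^ s / (1 - (1 / 2 : ℝ) ^ (1 / 2 : ℝ)))), ?_,
      fun Ω ω hΩ _ _ hA hω x hx r hr hd => case_pos hn hCadr hs hΩ hA hω hx hr hd⟩
    have h1 : (6:ℝ) ^ (-s) < 5 ^ (-s) :=
      Real.rpow_lt_rpow_of_neg (by norm_num) (by norm_num) (by rw [hs]; linarith)
    have h2 : (1 / 2 : ℝ) ^ (1 / 2 : ℝ) < 1 :=
      Real.rpow_lt_one (by norm_num) (by norm_num) (by norm_num)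
    have h3 : 0 < (5:ℝ) ^ (-s) - 6 ^ (-s) := by linarith
    have h4 : 0 < 1 - (1 / 2 : ℝ) ^ (1 / 2 : ℝ) := by linarith
    have h5 : 0 < Cadr := by linarith
    positivity
end
end
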